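/- arXiv:1702.07049 — 5 statements merged into one kernel-verified Lean document; each statement's English description precedes it below -/
import Mathlib

section
/- Let m : ℤ → ℂ be a bounded sequence satisfying sup_{N ∈ ℕ} ∑_{N ≤ |n| ≤ 2N} |m(n)|² < ∞. Then for every measurable function f : 𝕋 → ℂ with ∫_𝕋 |f(θ)| log^{1/2}(1 + |f(θ)|) dθ < ∞, one has ∑_{n ∈ ℤ} |m(n) f̂(n)|² < ∞. -/
open MeasureTheory ENNReal NNReal

open AddCircle ComplexConjugate

/-- The trigonometric polynomials on the circle with frequencies in `A`. -/
noncomputable def trigSpan (A : Set ℤ) : Submodule ℂ C(AddCircle (1 : ℝ), ℂ) :=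
  Submodule.span ℂ ((fun n : ℤ => fourier n) '' A)

lemma fourier_mem_trigSpan {A : Set ℤ} {n : ℤ} (hn : n ∈ A) :
    (fourier n : C(AddCircle (1 : ℝ), ℂ)) ∈ trigSpan A :=
  Submodule.subset_span ⟨n, hn, rfl⟩

lemma one_mem_trigSpan {A : Set ℤ} (h : (0 : ℤ) ∈ A) :
    (1 : C(AddCircle (1 : ℝ), ℂ)) ∈ trigSpan A := by
  convert fourier_mem_trigSpan h
  ext x
  simp

lemma trigSpan_mono {A B : Set ℤ} (h : A ⊆ B) : trigSpan A ≤ trigSpan B :=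
  Submodule.span_mono (Set.image_mono h)

lemma mul_mem_trigSpan {A B D : Set ℤ} (h : ∀ a ∈ A, ∀ b ∈ B, a + b ∈ D)
    {F G : C(AddCircle (1 : ℝ), ℂ)} (hF : F ∈ trigSpan A) (hG : G ∈ trigSpan B) :
    F * G ∈ trigSpan D := by
  have := Submodule.mul_mem_mul hF hG
  rw [trigSpan, trigSpan, Submodule.span_mul_span] at this
  refine Submodule.span_mono ?_ this
  rintro _ ⟨_, ⟨a, ha, rfl⟩, _, ⟨b, hb, rfl⟩, rfl⟩
  refine ⟨a + b, h a ha b hb, ?_⟩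
  ext x
  simp

lemma integrable_continuousMap_circle (F : C(AddCircle (1 : ℝ), ℂ)) :
    Integrable F haarAddCircle :=
  F.continuous.integrable_of_hasCompactSupport (HasCompactSupport.of_compactSpace _)

lemma integral_fourier_eq_zero {n : ℤ} (hn : n ≠ 0) :
    ∫ x : AddCircle (1 : ℝ), fourier n x ∂haarAddCircle = 0 :=
  integral_eq_zero_of_add_right_eq_neg (μ := haarAddCircle)
    (fourier_add_half_inv_index hn one_pos)

lemma integral_eq_zero_of_mem_trigSpan {A : Set ℤ} (hA : (0 : ℤ) ∉ A)
    {F : C(AddCircle (1 : ℝ), ℂ)} (hF : F ∈ trigSpan A) :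
    ∫ x, F x ∂haarAddCircle = 0 := by
  induction hF using Submodule.span_induction with
  | mem F h =>
    obtain ⟨n, hn, rfl⟩ := h
    exact integral_fourier_eq_zero fun h => hA (h ▸ hn)
  | zero => simp
  | add F G _ _ hF hG =>
    simp only [ContinuousMap.add_apply]
    rw [integral_add (integrable_continuousMap_circle F) (integrable_continuousMap_circle G),
      hF, hG, add_zero]
  | smul c F _ hF =>
    simp only [ContinuousMap.smul_apply]
    rw [integral_smul, hF, smul_zero]

/-- Products of affine functions of dyadic blocks of the same parity have no cross terms. -/
lemma prod_dyadic_blocks (p : ℕ) (x : ℕ → C(AddCircle (1 : ℝ), ℂ))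
    (hx : ∀ k, x k ∈ trigSpan {n | 2 ^ k ≤ |n| ∧ |n| < 2 ^ (k + 1)}) (α β : ℕ → ℂ)
    (K : Finset ℕ) (hK : ∀ k ∈ K, k % 2 = p) :
    (∀ J, J % 2 = p → (∀ k ∈ K, k < J) →
      ∏ k ∈ K, (α k • 1 + β k • x k) ∈ trigSpan {n | 3 * |n| ≤ 2 * 2 ^ J}) ∧
    ∫ θ, (∏ k ∈ K, (α k • 1 + β k • x k)) θ ∂haarAddCircle = ∏ k ∈ K, α k := by
  induction K using Finset.induction_on_max with
  | empty =>
    refine ⟨fun J _ _ => ?_, by simp⟩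
    simpa using one_mem_trigSpan (A := {n : ℤ | 3 * |n| ≤ 2 * 2 ^ J}) (by simp)
  | insert a K ha ih =>
    have haK : a ∉ K := fun h => lt_irrefl _ (ha a h)
    obtain ⟨ih₁, ih₂⟩ := ih fun k hk => hK k (Finset.mem_insert_of_mem hk)
    have hap := hK a (Finset.mem_insert_self _ _)
    have hP := ih₁ a hap ha
    rw [Finset.prod_insert haK, Finset.prod_insert haK]
    set P := ∏ k ∈ K, (α k • 1 + β k • x k) with hPdef
    refine ⟨fun J hJ hJK => ?_, ?_⟩
    · have haJ : a + 2 ≤ J := by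
        have := hJK a (Finset.mem_insert_self _ _)
        omega
      have hpow : (2 : ℤ) ^ (a + 2) ≤ 2 ^ J := pow_le_pow_right₀ (by norm_num) haJ
      have e1 : (2 : ℤ) ^ (a + 2) = 4 * 2 ^ a := by ring
      have e2 : (2 : ℤ) ^ (a + 1) = 2 * 2 ^ a := by ring
      have h2 : (0 : ℤ) < 2 ^ a := by positivity
      refine mul_mem_trigSpan (A := {n | |n| < 2 ^ (a + 1)}) (fun b hb c hc => ?_)
        (Submodule.add_mem _ (Submodule.smul_mem _ _ (one_mem_trigSpan ?_))
          (Submodule.smul_mem _ _ (trigSpan_mono (fun n hn => hn.2) (hx a)))) hP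
      · simp only [Set.mem_ofPred_eq] at hb hc ⊢
        have := abs_add_le b c
        omega
      · simp
    · have hz : ∫ θ, (x a * P) θ ∂haarAddCircle = 0 := by
        refine integral_eq_zero_of_mem_trigSpan (A := {n : ℤ | n ≠ 0}) (by simp)
          (mul_mem_trigSpan (fun b hb c hc => ?_) (hx a) hP)
        simp only [Set.mem_ofPred_eq] at hb hc ⊢
        intro h
        have h2 : (0 : ℤ) < 2 ^ a := by positivity
        have : b = -c := by omega
        rw [this, abs_neg] at hb
        omega
      have hexp : ∀ θ, ((α a • 1 + β a • x a) * P) θ = α a * P θ + β a * (x a * P) θ := by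
        intro θ
        simp
        ring
      simp_rw [hexp]
      rw [integral_add ((integrable_continuousMap_circle P).const_mul _)
        ((integrable_continuousMap_circle (x a * P)).const_mul _), integral_const_mul,
        integral_const_mul, hz, ih₂]
      simp

lemma real_mul_le_add_exp (s t : ℝ) (hs : 0 ≤ s) :
    ∃ j : ℕ, s * t ≤ 2 * (1 + √(Real.log (1 + s))) * s + Real.exp (j * t - j ^ 2) := by
  set r := √(Real.log (1 + s)) with hr
  set j : ℕ := ⌊r⌋₊ + 1 with hj
  have hr0 : 0 ≤ r := Real.sqrt_nonneg _
  have hjr : (j : ℝ) ≤ 1 + r := by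
    have := Nat.floor_le hr0
    push_cast [hj]
    linarith
  have hrj : r ≤ j := by
    have := (Nat.lt_floor_add_one r).le
    push_cast [hj]
    linarith
  have hj1 : (1 : ℝ) ≤ j := by simp [hj]
  have hsj : s ≤ Real.exp (j ^ 2) := by
    have h1 : Real.log (1 + s) ≤ (j : ℝ) ^ 2 := (Real.sqrt_le_left (by linarith)).1 hrj
    have h2 := (Real.log_le_iff_le_exp (by linarith)).1 h1
    linarith
  refine ⟨j, ?_⟩
  rcases le_total t (2 * j) with ht | ht
  · nlinarith [Real.exp_pos (j * t - (j : ℝ) ^ 2)]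
  · have h1 : t - 2 * j ≤ Real.exp (j * (t - 2 * j)) := by
      have := Real.add_one_le_exp (j * (t - 2 * j))
      nlinarith
    have h2 : s * (t - 2 * j) ≤ Real.exp (j ^ 2) * Real.exp (j * (t - 2 * j)) :=
      mul_le_mul hsj h1 (by linarith) (Real.exp_pos _).le
    rw [← Real.exp_add] at h2
    have h3 : (j : ℝ) ^ 2 + j * (t - 2 * j) = j * t - j ^ 2 := by ring
    rw [h3] at h2
    nlinarith

/-- A dyadic analogue of the Young function `t ↦ exp (t ^ 2 / 4)`. -/
noncomputable def expSqSum (t : ℝ) : ℝ≥0∞ :=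
  ∑' j : ℕ, ENNReal.ofReal (Real.exp (j * t - j ^ 2))

lemma measurable_expSqSum : Measurable expSqSum :=
  Measurable.tsum fun j => by fun_prop

lemma ofReal_mul_le_add_expSqSum (s t : ℝ) (hs : 0 ≤ s) :
    ENNReal.ofReal (s * t) ≤
      ENNReal.ofReal (2 * (1 + √(Real.log (1 + s))) * s) + expSqSum t := by
  obtain ⟨j, hj⟩ := real_mul_le_add_exp s t hs
  exact ((ENNReal.ofReal_le_ofReal hj).trans ENNReal.ofReal_add_le).trans
    (add_le_add_right (ENNReal.le_tsum j) _)

lemma tsum_exp_neg_sq_ne_top :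
    ∑' j : ℕ, ENNReal.ofReal (Real.exp (-(j : ℝ) ^ 2 / 2)) ≠ ∞ := by
  refine Summable.tsum_ofReal_ne_top (Summable.of_nonneg_of_le (fun _ => (Real.exp_pos _).le)
    (fun j => ?_) (Real.summable_exp_nat_mul_iff.2 (show (-1 / 2 : ℝ) < 0 by norm_num)))
  rw [Real.exp_le_exp]
  have : (j : ℝ) ≤ (j : ℝ) ^ 2 := by exact_mod_cast Nat.le_self_pow (by norm_num) j
  linarith

lemma exp_le_cosh_add {x c : ℝ} (h : |x| ≤ c) :
    Real.exp x ≤ Real.cosh c + Real.sinh c / c * x := by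
  rcases ((abs_nonneg x).trans h).eq_or_lt with hc | hc
  · have : x = 0 := by simpa [← hc] using h
    simp [this, ← hc]
  · have := Real.exp_mul_le_cosh_add_mul_sinh (t := x / c)
      (by rwa [abs_div, abs_of_pos hc, div_le_one hc]) c
    rw [div_mul_cancel₀ _ hc.ne'] at this
    calc _ ≤ _ := this
      _ = _ := by ring

/-- Distinct dyadic blocks of the same parity behave like independent bounded random variables:
their sum is subgaussian. -/
lemma integral_exp_re_trig_le (p : ℕ) (S : Finset ℤ)
    (hS : ∀ n ∈ S, n ≠ 0 ∧ Nat.log 2 n.natAbs % 2 = p) (a : ℤ → ℂ) :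
    ∫ θ : AddCircle (1 : ℝ), Real.exp (∑ n ∈ S, a n * fourier (-n) θ).re ∂haarAddCircle ≤
      Real.exp ((∑ k ∈ S.image fun n => Nat.log 2 n.natAbs,
        (∑ n ∈ S with Nat.log 2 n.natAbs = k, ‖a n‖) ^ 2) / 2) := by
  set K := S.image fun n : ℤ => Nat.log 2 n.natAbs with hK
  set c : ℕ → ℝ := fun k => ∑ n ∈ S with Nat.log 2 n.natAbs = k, ‖a n‖ with hc
  let u : ℕ → AddCircle (1 : ℝ) → ℝ := fun k θ =>
    (∑ n ∈ S with Nat.log 2 n.natAbs = k, a n * fourier (-n) θ).re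
  let x : ℕ → C(AddCircle (1 : ℝ), ℂ) := fun k =>
    ∑ n ∈ S with Nat.log 2 n.natAbs = k, ((a n / 2) • fourier (-n) + (conj (a n) / 2) • fourier n)
  have hxu : ∀ k θ, x k θ = (u k θ : ℂ) := by
    intro k θ
    simp only [x, u, ContinuousMap.coe_sum, Finset.sum_apply, ContinuousMap.add_apply,
      ContinuousMap.smul_apply, smul_eq_mul, Complex.re_sum, Complex.ofReal_sum]
    refine Finset.sum_congr rfl fun n _ => ?_
    rw [Complex.re_eq_add_conj, map_mul, fourier_neg, Complex.conj_conj]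
    ring
  have hu : ∀ k θ, |u k θ| ≤ c k := fun k θ =>
    (Complex.abs_re_le_norm _).trans <| (norm_sum_le _ _).trans_eq <|
      Finset.sum_congr rfl fun n _ => by rw [norm_mul, fourier_apply, Circle.norm_coe, mul_one]
  have hcont : ∀ k, Continuous (u k) := fun k => by fun_prop
  have hx : ∀ k, x k ∈ trigSpan {n | 2 ^ k ≤ |n| ∧ |n| < 2 ^ (k + 1)} := by
    intro k
    refine Submodule.sum_mem _ fun n hn => ?_
    obtain ⟨hnS, hnk⟩ := Finset.mem_filter.1 hn
    have hn0 := (hS n hnS).1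
    have h1 := Nat.pow_log_le_self 2 (Int.natAbs_ne_zero.2 hn0)
    have h2 := Nat.lt_pow_succ_log_self (b := 2) (by norm_num) n.natAbs
    rw [hnk] at h1 h2
    have hmem : (2 : ℤ) ^ k ≤ |n| ∧ |n| < 2 ^ (k + 1) := by
      rw [Int.abs_eq_natAbs]
      exact ⟨by exact_mod_cast h1, by exact_mod_cast h2⟩
    refine Submodule.add_mem _ (Submodule.smul_mem _ _ (fourier_mem_trigSpan ?_))
      (Submodule.smul_mem _ _ (fourier_mem_trigSpan hmem))
    simpa only [Set.mem_ofPred_eq, abs_neg] using hmem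
  have hKp : ∀ k ∈ K, k % 2 = p := by
    intro k hk
    obtain ⟨n, hn, rfl⟩ := Finset.mem_image.1 hk
    exact (hS n hn).2
  have hprod := (prod_dyadic_blocks p x hx (fun k => Real.cosh (c k))
    (fun k => (Real.sinh (c k) / c k : ℝ)) K hKp).2
  have hreal : ∫ θ, ∏ k ∈ K, (Real.cosh (c k) + Real.sinh (c k) / c k * u k θ) ∂haarAddCircle =
      ∏ k ∈ K, Real.cosh (c k) := by
    rw [← Complex.ofReal_inj, ← integral_complex_ofReal, Complex.ofReal_prod, ← hprod]
    congr 1 with θ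
    simp [ContinuousMap.prod_apply, hxu]
  have hsum : ∀ θ : AddCircle (1 : ℝ),
      (∑ n ∈ S, a n * fourier (-n) θ).re = ∑ k ∈ K, u k θ := by
    intro θ
    rw [← Finset.sum_fiberwise_of_maps_to (g := fun n : ℤ => Nat.log 2 n.natAbs) (t := K)
      fun n hn => Finset.mem_image_of_mem _ hn, Complex.re_sum]
  calc _ ≤ ∫ θ, ∏ k ∈ K, (Real.cosh (c k) + Real.sinh (c k) / c k * u k θ) ∂haarAddCircle := by
        refine integral_mono ?_ ?_ fun θ => ?_
        · exact Continuous.integrable_of_hasCompactSupport (by fun_prop)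
            (HasCompactSupport.of_compactSpace _)
        · exact Continuous.integrable_of_hasCompactSupport (by fun_prop)
            (HasCompactSupport.of_compactSpace _)
        · simp only [hsum, Real.exp_sum]
          exact Finset.prod_le_prod (fun _ _ => (Real.exp_pos _).le)
            fun k _ => exp_le_cosh_add (hu k θ)
    _ = ∏ k ∈ K, Real.cosh (c k) := hreal
    _ ≤ ∏ k ∈ K, Real.exp (c k ^ 2 / 2) :=
        Finset.prod_le_prod (fun _ _ => (Real.cosh_pos _).le) fun _ _ => Real.cosh_le_exp_half_sq _
    _ = _ := by rw [← Real.exp_sum, Finset.sum_div]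

lemma lintegral_expSqSum_re_trig_le (p : ℕ) (S : Finset ℤ)
    (hS : ∀ n ∈ S, n ≠ 0 ∧ Nat.log 2 n.natAbs % 2 = p) (a : ℤ → ℂ)
    (ha : ∑ k ∈ S.image fun n => Nat.log 2 n.natAbs,
        (∑ n ∈ S with Nat.log 2 n.natAbs = k, ‖a n‖) ^ 2 ≤ 1) (w : ℂ) (hw : ‖w‖ = 1) :
    ∫⁻ θ : AddCircle (1 : ℝ), expSqSum (w * ∑ n ∈ S, a n * fourier (-n) θ).re ∂haarAddCircle ≤
      ∑' j : ℕ, ENNReal.ofReal (Real.exp (-(j : ℝ) ^ 2 / 2)) := by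
  unfold expSqSum
  rw [lintegral_tsum fun j => Measurable.aemeasurable (by fun_prop)]
  refine ENNReal.tsum_le_tsum fun j => ?_
  rw [← ofReal_integral_eq_lintegral_ofReal
    (Continuous.integrable_of_hasCompactSupport (by fun_prop)
      (HasCompactSupport.of_compactSpace _)) (ae_of_all _ fun _ => (Real.exp_pos _).le)]
  refine ENNReal.ofReal_le_ofReal ?_
  have h := integral_exp_re_trig_le p S hS fun n => j * w * a n
  have e1 : ∀ θ : AddCircle (1 : ℝ), (∑ n ∈ S, j * w * a n * fourier (-n) θ).re =
      j * (w * ∑ n ∈ S, a n * fourier (-n) θ).re := by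
    intro θ
    rw [← Complex.re_ofReal_mul, Finset.mul_sum, Finset.mul_sum]
    congr 1
    refine Finset.sum_congr rfl fun n _ => ?_
    push_cast
    ring
  have e2 : ∑ k ∈ S.image fun n => Nat.log 2 n.natAbs,
      (∑ n ∈ S with Nat.log 2 n.natAbs = k, ‖j * w * a n‖) ^ 2 = (j : ℝ) ^ 2 *
      ∑ k ∈ S.image fun n => Nat.log 2 n.natAbs,
        (∑ n ∈ S with Nat.log 2 n.natAbs = k, ‖a n‖) ^ 2 := by
    simp only [norm_mul, hw, Complex.norm_natCast, mul_one, ← Finset.mul_sum, mul_pow]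
  simp only [e1, e2] at h
  simp only [sub_eq_add_neg, Real.exp_add]
  rw [integral_mul_const]
  refine (mul_le_mul_of_nonneg_right h (Real.exp_pos _).le).trans ?_
  rw [← Real.exp_add, Real.exp_le_exp]
  nlinarith [mul_le_mul_of_nonneg_left ha (sq_nonneg (j : ℝ))]

lemma norm_le_sum_re_mul (z : ℂ) :
    ‖z‖ ≤ max (1 * z).re 0 + max (-1 * z).re 0 + max (Complex.I * z).re 0 +
      max (-Complex.I * z).re 0 := by
  have h := Complex.norm_le_abs_re_add_abs_im z
  simp only [Complex.mul_re, Complex.one_re, Complex.one_im, Complex.neg_re, Complex.neg_im,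
    Complex.I_re, Complex.I_im]
  have h1 : |z.re| ≤ max (1 * z.re - 0 * z.im) 0 + max (-1 * z.re - -0 * z.im) 0 := by
    rcases abs_cases z.re with h | h <;> rw [h.1] <;>
      linarith [le_max_left (1 * z.re - 0 * z.im) 0, le_max_left (-1 * z.re - -0 * z.im) 0,
        le_max_right (1 * z.re - 0 * z.im) 0, le_max_right (-1 * z.re - -0 * z.im) 0]
  have h2 : |z.im| ≤ max (0 * z.re - 1 * z.im) 0 + max (-0 * z.re - -1 * z.im) 0 := by
    rcases abs_cases z.im with h | h <;> rw [h.1] <;>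
      linarith [le_max_left (0 * z.re - 1 * z.im) 0, le_max_left (-0 * z.re - -1 * z.im) 0,
        le_max_right (0 * z.re - 1 * z.im) 0, le_max_right (-0 * z.re - -1 * z.im) 0]
  linarith

lemma ofReal_mul_norm_le (s : ℝ) (hs : 0 ≤ s) (z : ℂ) :
    ENNReal.ofReal (s * ‖z‖) ≤ 4 * ENNReal.ofReal (2 * (1 + √(Real.log (1 + s))) * s) +
      (expSqSum (1 * z).re + expSqSum (-1 * z).re + expSqSum (Complex.I * z).re +
        expSqSum (-Complex.I * z).re) := by
  have key : ∀ t, ENNReal.ofReal (s * max t 0) ≤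
      ENNReal.ofReal (2 * (1 + √(Real.log (1 + s))) * s) + expSqSum t := by
    intro t
    rcases le_total t 0 with ht | ht
    · simp [ht]
    · rw [max_eq_left ht]
      exact ofReal_mul_le_add_expSqSum s t hs
  calc _ ≤ ENNReal.ofReal (s * max (1 * z).re 0 + s * max (-1 * z).re 0 +
        s * max (Complex.I * z).re 0 + s * max (-Complex.I * z).re 0) := by
        refine ENNReal.ofReal_le_ofReal ?_
        have := mul_le_mul_of_nonneg_left (norm_le_sum_re_mul z) hs
        linarith
    _ ≤ ENNReal.ofReal (s * max (1 * z).re 0) + ENNReal.ofReal (s * max (-1 * z).re 0) +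
        ENNReal.ofReal (s * max (Complex.I * z).re 0) +
        ENNReal.ofReal (s * max (-Complex.I * z).re 0) := by
        refine ENNReal.ofReal_add_le.trans (add_le_add_left ?_ _)
        exact ENNReal.ofReal_add_le.trans (add_le_add_left ENNReal.ofReal_add_le _)
    _ ≤ _ := add_le_add (add_le_add (add_le_add (key _) (key _)) (key _)) (key _)
    _ = _ := by ring

lemma lintegral_norm_mul_trig_le (p : ℕ) (S : Finset ℤ)
    (hS : ∀ n ∈ S, n ≠ 0 ∧ Nat.log 2 n.natAbs % 2 = p) (a : ℤ → ℂ)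
    (ha : ∑ k ∈ S.image fun n => Nat.log 2 n.natAbs,
        (∑ n ∈ S with Nat.log 2 n.natAbs = k, ‖a n‖) ^ 2 ≤ 1)
    (f : AddCircle (1 : ℝ) → ℂ) :
    ∫⁻ θ, ENNReal.ofReal (‖f θ‖ * ‖∑ n ∈ S, a n * fourier (-n) θ‖) ∂haarAddCircle ≤
      4 * ∫⁻ θ, ENNReal.ofReal (2 * (1 + √(Real.log (1 + ‖f θ‖))) * ‖f θ‖) ∂haarAddCircle +
      4 * ∑' j : ℕ, ENNReal.ofReal (Real.exp (-(j : ℝ) ^ 2 / 2)) := by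
  have hm : ∀ w : ℂ, Measurable fun θ : AddCircle (1 : ℝ) =>
      expSqSum (w * ∑ n ∈ S, a n * fourier (-n) θ).re := fun w =>
    measurable_expSqSum.comp (Continuous.measurable (by fun_prop))
  refine (lintegral_mono fun θ => ofReal_mul_norm_le _ (norm_nonneg _) _).trans ?_
  rw [lintegral_add_right _ ((((hm 1).fun_add (hm (-1))).fun_add (hm Complex.I)).fun_add
      (hm (-Complex.I))),
    lintegral_const_mul' _ _ (by norm_num), lintegral_add_right _ (hm _),
    lintegral_add_right _ (hm _), lintegral_add_right _ (hm _)]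
  refine add_le_add_right ?_ _
  have key := lintegral_expSqSum_re_trig_le p S hS a ha
  refine (add_le_add (add_le_add (add_le_add (key 1 (by simp)) (key (-1) (by simp)))
    (key Complex.I (by simp))) (key (-Complex.I) (by simp))).trans_eq ?_
  ring

lemma le_two_add_mul_sqrt_log {s : ℝ} (hs : 0 ≤ s) : s ≤ 2 + s * √(Real.log (1 + s)) := by
  have h0 := mul_nonneg hs (Real.sqrt_nonneg (Real.log (1 + s)))
  rcases le_total s 2 with h | h
  · linarith
  · have h1 : 1 ≤ Real.log (1 + s) := by
      rw [Real.le_log_iff_exp_le (by linarith)]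
      linarith [Real.exp_one_lt_d9]
    nlinarith [Real.one_le_sqrt.2 h1]

lemma lintegral_one_add_sqrt_log_mul_ne_top {f : AddCircle (1 : ℝ) → ℂ}
    (hf : ∫⁻ θ, ENNReal.ofReal (‖f θ‖ * √(Real.log (1 + ‖f θ‖))) ∂haarAddCircle ≠ ∞) :
    ∫⁻ θ, ENNReal.ofReal (2 * (1 + √(Real.log (1 + ‖f θ‖))) * ‖f θ‖) ∂haarAddCircle ≠ ∞ := by
  have h : ∀ θ, ENNReal.ofReal (2 * (1 + √(Real.log (1 + ‖f θ‖))) * ‖f θ‖) ≤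
      ENNReal.ofReal 4 +
        ENNReal.ofReal 4 * ENNReal.ofReal (‖f θ‖ * √(Real.log (1 + ‖f θ‖))) := by
    intro θ
    rw [← ENNReal.ofReal_mul (by norm_num), ← ENNReal.ofReal_add (by norm_num) (by positivity)]
    exact ENNReal.ofReal_le_ofReal (by nlinarith [le_two_add_mul_sqrt_log (norm_nonneg (f θ))])
  refine ne_top_of_le_ne_top ?_ (lintegral_mono h)
  rw [lintegral_add_left measurable_const, lintegral_const_mul' _ _ ENNReal.ofReal_ne_top]
  exact ENNReal.add_ne_top.2 ⟨by simp, ENNReal.mul_ne_top ENNReal.ofReal_ne_top hf⟩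

lemma integrable_of_lintegral_mul_sqrt_log_ne_top {f : AddCircle (1 : ℝ) → ℂ}
    (hmeas : AEStronglyMeasurable f haarAddCircle)
    (hf : ∫⁻ θ, ENNReal.ofReal (‖f θ‖ * √(Real.log (1 + ‖f θ‖))) ∂haarAddCircle ≠ ∞) :
    Integrable f haarAddCircle := by
  refine ⟨hmeas, (lintegral_mono fun θ => ?_).trans_lt
    (lintegral_one_add_sqrt_log_mul_ne_top hf).lt_top⟩
  rw [← ofReal_norm]
  refine ENNReal.ofReal_le_ofReal ?_
  nlinarith [norm_nonneg (f θ), mul_nonneg (norm_nonneg (f θ))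
    (Real.sqrt_nonneg (Real.log (1 + ‖f θ‖)))]

lemma sum_mul_fourierCoeff_eq_integral {f : AddCircle (1 : ℝ) → ℂ}
    (hf : Integrable f haarAddCircle) (S : Finset ℤ) (a : ℤ → ℂ) :
    ∑ n ∈ S, a n * fourierCoeff f n =
      ∫ θ, f θ * ∑ n ∈ S, a n * fourier (-n) θ ∂haarAddCircle := by
  simp only [fourierCoeff, ← integral_const_mul]
  rw [← integral_finsetSum _ fun n _ => (hf.fourier_smul (-n)).const_mul _]
  congr 1 with θ
  rw [Finset.mul_sum]
  refine Finset.sum_congr rfl fun n _ => ?_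
  rw [smul_eq_mul]
  ring

lemma sum_dyadic_block_le {m : ℤ → ℂ} {C : ℝ}
    (hC : ∀ N : ℕ, 1 ≤ N →
      ∑ n ∈ (Finset.Icc (-(2 * (N : ℤ))) (2 * (N : ℤ))).filter (fun n => (N : ℤ) ≤ |n|),
        ‖m n‖ ^ 2 ≤ C) (S : Finset ℤ) (hS : ∀ n ∈ S, n ≠ 0) (k : ℕ) :
    ∑ n ∈ S with Nat.log 2 n.natAbs = k, ‖m n‖ ^ 2 ≤ C := by
  refine (Finset.sum_le_sum_of_subset_of_nonneg (fun n hn => ?_) fun _ _ _ => sq_nonneg _).trans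
    (hC (2 ^ k) Nat.one_le_two_pow)
  obtain ⟨hnS, hnk⟩ := Finset.mem_filter.1 hn
  have h1 := Nat.pow_log_le_self 2 (Int.natAbs_ne_zero.2 (hS n hnS))
  have h2 := Nat.lt_pow_succ_log_self (b := 2) (by norm_num) n.natAbs
  rw [hnk] at h1 h2
  rw [pow_succ] at h2
  rw [Finset.mem_filter, Finset.mem_Icc]
  push_cast
  zify at h1 h2
  rw [← abs_le]
  omega

/-- The `ℓ²` bound for `m n * fourierCoeff f n` over dyadic blocks of one parity. -/
lemma sum_sq_mul_fourierCoeff_le {m : ℤ → ℂ} {C : ℝ}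
    (hC : ∀ N : ℕ, 1 ≤ N →
      ∑ n ∈ (Finset.Icc (-(2 * (N : ℤ))) (2 * (N : ℤ))).filter (fun n => (N : ℤ) ≤ |n|),
        ‖m n‖ ^ 2 ≤ C)
    {f : AddCircle (1 : ℝ) → ℂ} (hmeas : AEStronglyMeasurable f haarAddCircle)
    (hf : ∫⁻ θ, ENNReal.ofReal (‖f θ‖ * √(Real.log (1 + ‖f θ‖))) ∂haarAddCircle ≠ ∞) (p : ℕ) :
    ∃ R : ℝ, ∀ S : Finset ℤ, (∀ n ∈ S, n ≠ 0 ∧ Nat.log 2 n.natAbs % 2 = p) →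
      ∑ n ∈ S, ‖m n * fourierCoeff f n‖ ^ 2 ≤ R := by
  set D : ℝ≥0∞ :=
    4 * ∫⁻ θ, ENNReal.ofReal (2 * (1 + √(Real.log (1 + ‖f θ‖))) * ‖f θ‖) ∂haarAddCircle +
      4 * ∑' j : ℕ, ENNReal.ofReal (Real.exp (-(j : ℝ) ^ 2 / 2)) with hD
  have hDtop : D ≠ ∞ := ENNReal.add_ne_top.2
    ⟨ENNReal.mul_ne_top (by norm_num) (lintegral_one_add_sqrt_log_mul_ne_top hf),
      ENNReal.mul_ne_top (by norm_num) tsum_exp_neg_sq_ne_top⟩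
  have hC0 : 0 ≤ C := (Finset.sum_nonneg fun _ _ => sq_nonneg _).trans (hC 1 le_rfl)
  refine ⟨(C + 1) * D.toReal ^ 2, fun S hS => ?_⟩
  set g : ℤ → ℂ := fun n => m n * fourierCoeff f n with hg
  have hQ0 : 0 ≤ ∑ n ∈ S, ‖g n‖ ^ 2 := Finset.sum_nonneg fun _ _ => sq_nonneg _
  rcases hQ0.eq_or_lt with hQ | hQ
  · rw [← hQ]
    positivity
  set A := √(∑ n ∈ S, ‖g n‖ ^ 2) with hA
  set B := √(C + 1) with hB
  have hApos : 0 < A := Real.sqrt_pos.2 hQ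
  have hBpos : 0 < B := Real.sqrt_pos.2 (by linarith)
  have hA2 : A ^ 2 = ∑ n ∈ S, ‖g n‖ ^ 2 := Real.sq_sqrt hQ0
  have hB2 : B ^ 2 = C + 1 := Real.sq_sqrt (by linarith)
  let a : ℤ → ℂ := fun n => conj (g n) * m n / (A * B : ℝ)
  have hnorm : ∀ n, ‖a n‖ = ‖g n‖ / A * (‖m n‖ / B) := by
    intro n
    simp only [a, norm_div, norm_mul, RCLike.norm_conj, Complex.norm_real, Real.norm_eq_abs,
      abs_of_pos hApos, abs_of_pos hBpos]
    field_simp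
  have ha : ∑ k ∈ S.image fun n => Nat.log 2 n.natAbs,
      (∑ n ∈ S with Nat.log 2 n.natAbs = k, ‖a n‖) ^ 2 ≤ 1 := by
    calc _ ≤ ∑ k ∈ S.image fun n => Nat.log 2 n.natAbs,
          ∑ n ∈ S with Nat.log 2 n.natAbs = k, (‖g n‖ / A) ^ 2 := by
          refine Finset.sum_le_sum fun k _ => ?_
          simp only [hnorm]
          refine (Finset.sum_mul_sq_le_sq_mul_sq _ _ _).trans
            (mul_le_of_le_one_right (Finset.sum_nonneg fun _ _ => sq_nonneg _) ?_)
          simp only [div_pow]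
          rw [← Finset.sum_div, hB2, div_le_one (by linarith)]
          linarith [sum_dyadic_block_le hC S (fun n hn => (hS n hn).1) k]
      _ = ∑ n ∈ S, (‖g n‖ / A) ^ 2 :=
          Finset.sum_fiberwise_of_maps_to (fun n hn => Finset.mem_image_of_mem _ hn) _
      _ = 1 := by
          simp only [div_pow]
          rw [← Finset.sum_div, ← hA2, div_self (by positivity)]
      _ ≤ 1 := le_rfl
  have hpair : ∑ n ∈ S, a n * fourierCoeff f n = ((A / B : ℝ) : ℂ) := by
    have h1 : ∀ n, a n * fourierCoeff f n = ((‖g n‖ ^ 2 / (A * B) : ℝ) : ℂ) := by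
      intro n
      have h2 := Complex.conj_mul' (g n)
      push_cast
      rw [← h2]
      simp only [a, hg]
      push_cast
      ring
    rw [Finset.sum_congr rfl fun n _ => h1 n, ← Complex.ofReal_sum, ← Finset.sum_div, ← hA2]
    congr 1
    field_simp
  have hle : ENNReal.ofReal (A / B) ≤ D := by
    have h1 := enorm_integral_le_lintegral_enorm (μ := haarAddCircle)
      fun θ => f θ * ∑ n ∈ S, a n * fourier (-n) θ
    rw [← sum_mul_fourierCoeff_eq_integral
      (integrable_of_lintegral_mul_sqrt_log_ne_top hmeas hf), hpair, ← ofReal_norm,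
      Complex.norm_real, Real.norm_of_nonneg (by positivity)] at h1
    refine h1.trans (le_trans (lintegral_mono fun θ => ?_) (lintegral_norm_mul_trig_le p S hS a ha f))
    rw [← ofReal_norm, norm_mul]
  have hle' := (ENNReal.ofReal_le_iff_le_toReal hDtop).1 hle
  rw [div_le_iff₀ hBpos] at hle'
  rw [← hA2, ← hB2, ← mul_pow, mul_comm B]
  exact pow_le_pow_left₀ hApos.le hle' 2

/-- **Multipliers from `H¹(𝕋)` to `L²(𝕋)` are multipliers from `L log^{1/2} L(𝕋)` to `L²(𝕋)`.**
If `m : ℤ → ℂ` is bounded and satisfies the Hardy–Littlewood/Duren–Shields condition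
`sup_{N ≥ 1} ∑_{N ≤ |n| ≤ 2N} |m n|² < ∞`, then for every measurable `f : 𝕋 → ℂ` with
`∫ |f| log^{1/2}(1+|f|) < ∞` one has `∑_{n ∈ ℤ} |m n * f̂ n|² < ∞`. -/
theorem paley_multiplier_is_zygmund_multiplier
    (m : ℤ → ℂ) (M : ℝ) (hM : ∀ n : ℤ, ‖m n‖ ≤ M)
    (C : ℝ)
    (hC : ∀ N : ℕ, 1 ≤ N →
      ∑ n ∈ (Finset.Icc (-(2 * (N : ℤ))) (2 * (N : ℤ))).filter (fun n => (N : ℤ) ≤ |n|),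
        ‖m n‖ ^ 2 ≤ C)
    (f : AddCircle (1 : ℝ) → ℂ)
    (hmeas : AEStronglyMeasurable f AddCircle.haarAddCircle)
    (hf : ∫⁻ θ, (‖f θ‖₊ : ℝ≥0∞) *
        ENNReal.ofReal (Real.log (1 + ‖f θ‖) ^ ((1 : ℝ) / 2)) ∂AddCircle.haarAddCircle ≠ ∞) :
    Summable fun n : ℤ => ‖m n * fourierCoeff f n‖ ^ 2 := by
  have hf' : ∫⁻ θ, ENNReal.ofReal (‖f θ‖ * √(Real.log (1 + ‖f θ‖))) ∂haarAddCircle ≠ ∞ := by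
    convert hf using 4 with θ
    rw [ENNReal.ofReal_mul (norm_nonneg _), ofReal_norm, Real.sqrt_eq_rpow]
    rfl
  obtain ⟨R₀, hR₀⟩ := sum_sq_mul_fourierCoeff_le hC hmeas hf' 0
  obtain ⟨R₁, hR₁⟩ := sum_sq_mul_fourierCoeff_le hC hmeas hf' 1
  refine summable_of_sum_le (c := ‖m 0 * fourierCoeff f 0‖ ^ 2 + (R₀ + R₁))
    (fun _ => sq_nonneg _) fun S => ?_
  have h₀ := hR₀ ((S.erase 0).filter fun n => Nat.log 2 n.natAbs % 2 = 0) fun n hn => by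
    simp only [Finset.mem_filter, Finset.mem_erase] at hn
    exact ⟨hn.1.1, hn.2⟩
  have h₁ := hR₁ ((S.erase 0).filter fun n => ¬ Nat.log 2 n.natAbs % 2 = 0) fun n hn => by
    simp only [Finset.mem_filter, Finset.mem_erase] at hn
    exact ⟨hn.1.1, by omega⟩
  have h := Finset.sum_filter_add_sum_filter_not (S.erase 0)
    (fun n => Nat.log 2 n.natAbs % 2 = 0) fun n => ‖m n * fourierCoeff f n‖ ^ 2
  have hins : ∑ n ∈ S, ‖m n * fourierCoeff f n‖ ^ 2 ≤
      ∑ n ∈ insert 0 (S.erase 0), ‖m n * fourierCoeff f n‖ ^ 2 :=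
    Finset.sum_le_sum_of_subset_of_nonneg (Finset.subset_insert_iff.2 subset_rfl)
      fun _ _ _ => sq_nonneg _
  rw [Finset.sum_insert (Finset.notMem_erase _ _)] at hins
  linarith
end

section
/- For every measurable function f : 𝕋 → ℂ with ∫_𝕋 |f(θ)| log^{1/2}(1 + |f(θ)|) dθ < ∞, one has ∑_{k ∈ ℕ₀} max_{2^k − 1 ≤ n ≤ 2^{k+1} − 2} |f̂(n)|² < ∞, where for each k ∈ ℕ₀ the maximum is taken over the integers n in the block I_k = [2^k − 1, 2^{k+1} − 2] ∩ ℕ₀. -/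
open MeasureTheory ENNReal NNReal

namespace DyadicBlockMaxima

open Finset Real

lemma exp_le_add_exp_sq (x : ℝ) : exp x ≤ x + exp (x ^ 2) := by
  have h2 := add_one_le_exp (x ^ 2)
  rcases le_total |x| 1 with h | h
  · have h1 := (abs_le.mp (abs_exp_sub_one_sub_id_le h)).2
    linarith
  · rcases le_abs'.mp h with h | h
    · have : exp x ≤ 1 := exp_le_one_iff.mpr (by linarith)
      nlinarith
    · have : exp x ≤ exp (x ^ 2) := exp_le_exp.mpr (by nlinarith)
      linarith

/-- Young's inequality for the pair `L log^{1/2} L`, `exp L²`. -/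
lemma mul_abs_le_log_add_exp_sq {u : ℝ} (hu : 0 ≤ u) (x : ℝ) :
    u * |x| ≤ 4 * (u * Real.log (1 + u) ^ ((1 : ℝ) / 2)) + 4 * exp (x ^ 2 / 8) := by
  rw [← Real.sqrt_eq_rpow]
  have hl : 0 ≤ Real.log (1 + u) := Real.log_nonneg (by linarith)
  rcases le_total |x| (4 * √(Real.log (1 + u))) with h | h
  · have := mul_le_mul_of_nonneg_left h hu
    have := exp_pos (x ^ 2 / 8)
    linarith
  · have h1 : Real.log (1 + u) ≤ x ^ 2 / 16 := by
      have h3 := Real.sq_sqrt hl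
      have h4 := sq_abs x
      have h5 := Real.sqrt_nonneg (Real.log (1 + u))
      nlinarith
    have h2 : 1 + u ≤ exp (x ^ 2 / 16) := (Real.log_le_iff_le_exp (by linarith)).mp h1
    have h3 : |x| ≤ 4 * exp (x ^ 2 / 16) := by
      have := add_one_le_exp (x ^ 2 / 16)
      nlinarith [sq_nonneg (|x| / 2 - 1), sq_abs x]
    have h4 : exp (x ^ 2 / 8) = exp (x ^ 2 / 16) * exp (x ^ 2 / 16) := by
      rw [← exp_add]; ring_nf
    have h5 : u * |x| ≤ exp (x ^ 2 / 16) * (4 * exp (x ^ 2 / 16)) :=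
      mul_le_mul (by linarith) h3 (abs_nonneg x) (exp_pos _).le
    have h6 := mul_nonneg hu (Real.sqrt_nonneg (Real.log (1 + u)))
    rw [h4]
    linarith

lemma summable_exp_neg_int_sq : Summable fun j : ℤ => exp (-(j : ℝ) ^ 2) := by
  have key : Summable fun n : ℕ => exp (-(n : ℝ) ^ 2) := by
    refine Summable.of_nonneg_of_le (fun n => (exp_pos _).le) (fun n => ?_)
      Real.summable_exp_neg_nat
    apply exp_le_exp.mpr
    have : (n : ℝ) ≤ (n : ℝ) ^ 2 := by exact_mod_cast Nat.le_self_pow two_ne_zero n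
    linarith
  refine Summable.of_nat_of_neg (by simpa using key) (by simpa using key)

lemma exp_sq_le_exp_round (x : ℝ) :
    exp (x ^ 2 / 8) ≤ exp (1 / 2) * exp (round (x / 4) * x - 2 * (round (x / 4) : ℝ) ^ 2) := by
  rw [← exp_add]
  apply exp_le_exp.mpr
  have h := abs_le.mp (abs_sub_round (x / 4))
  nlinarith [h.1, h.2]

/-- The trigonometric polynomial `∑_{k < N} a_k e(-m_k θ)`. -/
noncomputable def trigPoly (a : ℕ → ℂ) (m : ℕ → ℤ) (N : ℕ) (θ : AddCircle (1 : ℝ)) : ℂ :=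
  ∑ k ∈ range N, a k * fourier (-m k) θ

/-- The Riesz product `∏_{k < N} (c_k + Re (a_k e(-m_k θ)))`. -/
noncomputable def rieszProduct (c : ℕ → ℝ) (a : ℕ → ℂ) (m : ℕ → ℤ) (N : ℕ)
    (θ : AddCircle (1 : ℝ)) : ℝ :=
  ∏ k ∈ range N, (c k + (a k * fourier (-m k) θ).re)

@[fun_prop]
lemma continuous_trigPoly (a : ℕ → ℂ) (m : ℕ → ℤ) (N : ℕ) : Continuous (trigPoly a m N) := by
  unfold trigPoly; fun_prop

@[fun_prop]
lemma continuous_rieszProduct (c : ℕ → ℝ) (a : ℕ → ℂ) (m : ℕ → ℤ) (N : ℕ) :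
    Continuous (rieszProduct c a m N) := by
  unfold rieszProduct; fun_prop

lemma integrable_of_continuous {E : Type*} [NormedAddCommGroup E] {g : AddCircle (1 : ℝ) → E}
    (hg : Continuous g) : Integrable g AddCircle.haarAddCircle :=
  hg.integrable_of_hasCompactSupport (HasCompactSupport.of_compactSpace g)

lemma fourierCoeff_rieszProduct_succ (c : ℕ → ℝ) (a : ℕ → ℂ) (m : ℕ → ℤ) (N : ℕ) (q : ℤ) :
    fourierCoeff (fun θ => (rieszProduct c a m (N + 1) θ : ℂ)) q =
      c N * fourierCoeff (fun θ => (rieszProduct c a m N θ : ℂ)) q +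
      a N / 2 * fourierCoeff (fun θ => (rieszProduct c a m N θ : ℂ)) (q + m N) +
      starRingEnd ℂ (a N) / 2 *
        fourierCoeff (fun θ => (rieszProduct c a m N θ : ℂ)) (q - m N) := by
  simp only [fourierCoeff, smul_eq_mul, ← integral_const_mul]
  rw [← integral_add, ← integral_add]
  · congr 1
    ext θ
    have h : ((a N * fourier (-m N) θ).re : ℂ) =
        (a N * fourier (-m N) θ + starRingEnd ℂ (a N) * fourier (m N) θ) / 2 := by
      rw [Complex.re_eq_add_conj, map_mul, ← fourier_neg, neg_neg]
    rw [rieszProduct, prod_range_succ, ← rieszProduct]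
    push_cast
    rw [h, neg_add, neg_sub, sub_eq_add_neg, fourier_add, add_comm (m N), fourier_add]
    ring
  all_goals exact integrable_of_continuous (by fun_prop)

lemma fourierCoeff_rieszProduct (c : ℕ → ℝ) (a : ℕ → ℂ) {m : ℕ → ℤ} (hpos : ∀ k, 0 < m k)
    (hm : ∀ N, ∑ k ∈ range N, m k < m N) (N : ℕ) :
    fourierCoeff (fun θ => (rieszProduct c a m N θ : ℂ)) 0 = ∏ k ∈ range N, (c k : ℂ) ∧
    ∀ q : ℤ, ∑ k ∈ range N, m k < |q| →
      fourierCoeff (fun θ => (rieszProduct c a m N θ : ℂ)) q = 0 := by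
  induction N with
  | zero =>
    have h : (fun θ => (rieszProduct c a m 0 θ : ℂ)) = fourier 0 := by
      ext θ; simp [rieszProduct]
    rw [h]
    rw [fourierCoeff_fourier]
    refine ⟨by simp, fun q hq => ?_⟩
    have hq : q ≠ 0 := by simpa using hq
    simp [hq]
  | succ N ih =>
    obtain ⟨ih0, ih⟩ := ih
    have hN := hm N
    have hp := hpos N
    constructor
    · rw [fourierCoeff_rieszProduct_succ, ih0, ih (0 + m N), ih (0 - m N), prod_range_succ]
      · ring
      · rw [zero_sub, abs_neg, abs_of_pos hp]; exact hN
      · rw [zero_add, abs_of_pos hp]; exact hN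
    · intro q hq
      rw [sum_range_succ] at hq
      rw [fourierCoeff_rieszProduct_succ, ih q, ih (q + m N), ih (q - m N)]
      · simp
      all_goals rw [lt_abs] at hq ⊢; omega

lemma integral_rieszProduct (c : ℕ → ℝ) (a : ℕ → ℂ) {m : ℕ → ℤ} (hpos : ∀ k, 0 < m k)
    (hm : ∀ N, ∑ k ∈ range N, m k < m N) (N : ℕ) :
    ∫ θ, rieszProduct c a m N θ ∂AddCircle.haarAddCircle = ∏ k ∈ range N, c k := by
  have h := (fourierCoeff_rieszProduct c a hpos hm N).1
  simp only [fourierCoeff, neg_zero, fourier_zero, one_smul] at h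
  rw [integral_complex_ofReal] at h
  exact_mod_cast h

lemma integral_exp_re_trigPoly_le (a : ℕ → ℂ) {m : ℕ → ℤ} (hpos : ∀ k, 0 < m k)
    (hm : ∀ N, ∑ k ∈ range N, m k < m N) (N : ℕ) :
    ∫ θ, exp (trigPoly a m N θ).re ∂AddCircle.haarAddCircle ≤
      exp (∑ k ∈ range N, ‖a k‖ ^ 2) := by
  rw [exp_sum, ← integral_rieszProduct (fun k => exp (‖a k‖ ^ 2)) a hpos hm]
  refine integral_mono (integrable_of_continuous (by fun_prop))
    (integrable_of_continuous (by fun_prop)) fun θ => ?_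
  simp only [trigPoly, rieszProduct, Complex.re_sum, exp_sum]
  refine prod_le_prod (fun k _ => (exp_pos _).le) fun k _ => ?_
  have h1 := exp_le_add_exp_sq (a k * fourier (-m k) θ).re
  have h2 : (a k * fourier (-m k) θ).re ^ 2 ≤ ‖a k‖ ^ 2 := by
    rw [← sq_abs]
    gcongr
    refine (Complex.abs_re_le_norm _).trans ?_
    rw [norm_mul, fourier_apply, Circle.norm_coe, mul_one]
  have := exp_le_exp.mpr h2
  linarith

/-- The exponential square integrability constant of lacunary series. -/
noncomputable def expSqConst : ℝ≥0∞ :=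
  ∑' j : ℤ, ENNReal.ofReal (exp (1 / 2) * exp (-(j : ℝ) ^ 2))

lemma expSqConst_ne_top : expSqConst ≠ ∞ :=
  (summable_exp_neg_int_sq.mul_left _).tsum_ofReal_ne_top

lemma lintegral_exp_sq_re_trigPoly_le {a : ℕ → ℂ} {m : ℕ → ℤ} (hpos : ∀ k, 0 < m k)
    (hm : ∀ N, ∑ k ∈ range N, m k < m N) {N : ℕ} (ha : ∑ k ∈ range N, ‖a k‖ ^ 2 ≤ 1) :
    ∫⁻ θ, ENNReal.ofReal (exp ((trigPoly a m N θ).re ^ 2 / 8)) ∂AddCircle.haarAddCircle ≤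
      expSqConst := by
  calc
    _ ≤ ∫⁻ θ, ∑' j : ℤ, ENNReal.ofReal
          (exp (1 / 2) * exp (j * (trigPoly a m N θ).re - 2 * (j : ℝ) ^ 2))
          ∂AddCircle.haarAddCircle := by
      refine lintegral_mono fun θ => ?_
      exact (ENNReal.ofReal_le_ofReal (exp_sq_le_exp_round _)).trans
        (ENNReal.le_tsum (f := fun j : ℤ => ENNReal.ofReal
          (exp (1 / 2) * exp (j * (trigPoly a m N θ).re - 2 * (j : ℝ) ^ 2))) _)
    _ = ∑' j : ℤ, ∫⁻ θ, ENNReal.ofReal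
          (exp (1 / 2) * exp (j * (trigPoly a m N θ).re - 2 * (j : ℝ) ^ 2))
          ∂AddCircle.haarAddCircle := by
      refine lintegral_tsum fun j => Measurable.aemeasurable ?_
      refine Measurable.ennreal_ofReal (Continuous.measurable ?_)
      fun_prop
    _ ≤ expSqConst := by
      refine ENNReal.tsum_le_tsum fun j => ?_
      rw [← ofReal_integral_eq_lintegral_ofReal (integrable_of_continuous (by fun_prop))
        (ae_of_all _ fun θ => by positivity), integral_const_mul]
      refine ENNReal.ofReal_le_ofReal (mul_le_mul_of_nonneg_left ?_ (exp_pos _).le)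
      have h1 := integral_exp_re_trigPoly_le (fun k => (j : ℂ) * a k) hpos hm N
      have h2 : ∀ θ, (trigPoly (fun k => (j : ℂ) * a k) m N θ).re
          = j * (trigPoly a m N θ).re := by
        intro θ
        simp only [trigPoly, mul_assoc, ← mul_sum]
        rw [← Complex.ofReal_intCast, Complex.re_ofReal_mul]
      have h3 : ∑ k ∈ range N, ‖(j : ℂ) * a k‖ ^ 2 ≤ (j : ℝ) ^ 2 := by
        simp only [norm_mul, mul_pow, ← mul_sum, Complex.norm_intCast, sq_abs]
        exact mul_le_of_le_one_right (sq_nonneg _) ha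
      simp only [h2] at h1
      simp only [exp_sub, div_eq_mul_inv, integral_mul_const]
      rw [← exp_neg]
      calc _ ≤ exp ((j : ℝ) ^ 2) * exp (-(2 * (j : ℝ) ^ 2)) := by
            gcongr
            exact h1.trans (exp_le_exp.mpr h3)
        _ = _ := by rw [← exp_add]; ring_nf

/-- The `L log^{1/2} L` functional. -/
noncomputable def logHalfIntegral (f : AddCircle (1 : ℝ) → ℂ) : ℝ≥0∞ :=
  ∫⁻ θ, (‖f θ‖₊ : ℝ≥0∞) *
    ENNReal.ofReal (Real.log (1 + ‖f θ‖) ^ ((1 : ℝ) / 2)) ∂AddCircle.haarAddCircle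

lemma integrable_of_logHalfIntegral_ne_top {f : AddCircle (1 : ℝ) → ℂ}
    (hmeas : AEStronglyMeasurable f AddCircle.haarAddCircle) (hf : logHalfIntegral f ≠ ∞) :
    Integrable f AddCircle.haarAddCircle := by
  refine ⟨hmeas, ?_⟩
  have h : ∀ θ, ‖f θ‖ₑ ≤ 2 + (‖f θ‖₊ : ℝ≥0∞) *
      ENNReal.ofReal (Real.log (1 + ‖f θ‖) ^ ((1 : ℝ) / 2)) := by
    intro θ
    rcases le_total ‖f θ‖ 2 with h | h
    · refine le_trans ?_ le_self_add
      rw [← ofReal_norm]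
      simpa using ENNReal.ofReal_le_ofReal h
    · refine le_trans ?_ le_add_self
      refine le_mul_of_one_le_right' ?_
      rw [ENNReal.one_le_ofReal]
      refine Real.one_le_rpow ?_ (by norm_num)
      rw [Real.le_log_iff_exp_le (by linarith)]
      have := Real.exp_one_lt_d9
      linarith
  refine (lintegral_mono h).trans_lt ?_
  rw [lintegral_add_left measurable_const, lintegral_const]
  exact ENNReal.add_lt_top.mpr ⟨by simp, hf.lt_top⟩

lemma enorm_mul_le_log_add_exp_sq (z w : ℂ) :
    ‖w * z‖ₑ ≤ 8 * ((‖z‖₊ : ℝ≥0∞) *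
        ENNReal.ofReal (Real.log (1 + ‖z‖) ^ ((1 : ℝ) / 2))) +
      (4 * ENNReal.ofReal (exp (w.re ^ 2 / 8)) + 4 * ENNReal.ofReal (exp (w.im ^ 2 / 8))) := by
  have h1 := mul_abs_le_log_add_exp_sq (norm_nonneg z) w.re
  have h2 := mul_abs_le_log_add_exp_sq (norm_nonneg z) w.im
  have h3 := mul_le_mul_of_nonneg_left (Complex.norm_le_abs_re_add_abs_im w) (norm_nonneg z)
  have hl : 0 ≤ Real.log (1 + ‖z‖) ^ ((1 : ℝ) / 2) :=
    Real.rpow_nonneg (Real.log_nonneg (by linarith [norm_nonneg z])) _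
  have h : ‖w * z‖ ≤ 8 * (‖z‖ * Real.log (1 + ‖z‖) ^ ((1 : ℝ) / 2)) +
      (4 * exp (w.re ^ 2 / 8) + 4 * exp (w.im ^ 2 / 8)) := by
    rw [norm_mul]; linarith
  have := ENNReal.ofReal_le_ofReal h
  rw [ENNReal.ofReal_add (by positivity) (by positivity),
    ENNReal.ofReal_add (by positivity) (by positivity), ENNReal.ofReal_mul (p := 8) (by norm_num),
    ENNReal.ofReal_mul (p := 4) (by norm_num), ENNReal.ofReal_mul (p := 4) (by norm_num),
    ENNReal.ofReal_mul (norm_nonneg z), ofReal_norm,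
    ofReal_norm] at this
  simpa [enorm_eq_nnnorm] using this

lemma enorm_sum_mul_fourierCoeff_le {f : AddCircle (1 : ℝ) → ℂ}
    (hmeas : AEStronglyMeasurable f AddCircle.haarAddCircle) (hf : logHalfIntegral f ≠ ∞)
    {a : ℕ → ℂ} {m : ℕ → ℤ} (hpos : ∀ k, 0 < m k)
    (hm : ∀ N, ∑ k ∈ range N, m k < m N) {N : ℕ} (ha : ∑ k ∈ range N, ‖a k‖ ^ 2 ≤ 1) :
    ‖∑ k ∈ range N, a k * fourierCoeff f (m k)‖ₑ ≤
      8 * logHalfIntegral f + (4 * expSqConst + 4 * expSqConst) := by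
  have hint := integrable_of_logHalfIntegral_ne_top hmeas hf
  have h : ∑ k ∈ range N, a k * fourierCoeff f (m k) =
      ∫ θ, trigPoly a m N θ * f θ ∂AddCircle.haarAddCircle := by
    simp only [trigPoly, sum_mul, fourierCoeff, ← integral_const_mul, smul_eq_mul]
    rw [integral_finsetSum]
    · simp only [mul_assoc]
    · intro k _
      have hk : Integrable (fun θ => fourier (-m k) θ * f θ) AddCircle.haarAddCircle := by
        refine hint.bdd_mul (c := 1) (Continuous.aestronglyMeasurable (by fun_prop))
          (ae_of_all _ fun θ => ?_)
        rw [fourier_apply, Circle.norm_coe]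
      simpa only [mul_assoc] using hk.const_mul (a k)
  have him : ∀ θ, (trigPoly a m N θ).im = (trigPoly (fun k => -Complex.I * a k) m N θ).re := by
    intro θ
    simp only [trigPoly, mul_assoc, ← mul_sum]
    simp
  rw [h]
  refine (enorm_integral_le_lintegral_enorm _).trans ?_
  refine (lintegral_mono fun θ => enorm_mul_le_log_add_exp_sq (f θ) (trigPoly a m N θ)).trans ?_
  have hc : Measurable fun θ => ENNReal.ofReal (exp ((trigPoly a m N θ).re ^ 2 / 8)) :=
    Measurable.ennreal_ofReal (Continuous.measurable (by fun_prop))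
  have hc' : Measurable fun θ => ENNReal.ofReal (exp ((trigPoly a m N θ).im ^ 2 / 8)) :=
    Measurable.ennreal_ofReal (Continuous.measurable (by fun_prop))
  rw [lintegral_add_right _ (by fun_prop), lintegral_add_right _ (by fun_prop),
    lintegral_const_mul' _ _ (by simp), lintegral_const_mul' _ _ (by simp),
    lintegral_const_mul' _ _ (by simp)]
  refine add_le_add le_rfl (add_le_add ?_ ?_)
  · gcongr
    exact lintegral_exp_sq_re_trigPoly_le hpos hm ha
  · gcongr
    simp only [him]
    exact lintegral_exp_sq_re_trigPoly_le hpos hm (by simpa using ha)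

/-- Zygmund's inequality: Fourier coefficients of an `L log^{1/2} L` function along a lacunary
sequence are square summable. -/
lemma summable_sq_fourierCoeff_of_lacunary {f : AddCircle (1 : ℝ) → ℂ}
    (hmeas : AEStronglyMeasurable f AddCircle.haarAddCircle) (hf : logHalfIntegral f ≠ ∞)
    {m : ℕ → ℤ} (hpos : ∀ k, 0 < m k) (hm : ∀ N, ∑ k ∈ range N, m k < m N) :
    Summable fun k => ‖fourierCoeff f (m k)‖ ^ 2 := by
  set B : ℝ≥0∞ := 8 * logHalfIntegral f + (4 * expSqConst + 4 * expSqConst)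
  have hB : B ≠ ∞ := by
    have := expSqConst_ne_top
    simp only [B]
    finiteness
  refine summable_of_sum_range_le (c := B.toReal ^ 2) (fun k => by positivity) fun N => ?_
  set S := ∑ k ∈ range N, ‖fourierCoeff f (m k)‖ ^ 2 with hS
  rcases (show 0 ≤ S by positivity).eq_or_lt with h0 | h0
  · rw [← h0]; positivity
  have hs : 0 < √S := Real.sqrt_pos.mpr h0
  have hss : √S ^ 2 = S := Real.sq_sqrt h0.le
  have h := enorm_sum_mul_fourierCoeff_le hmeas hf hpos hm (N := N)
    (a := fun k => ((√S)⁻¹ : ℝ) * starRingEnd ℂ (fourierCoeff f (m k))) (by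
      simp only [norm_mul, mul_pow, ← mul_sum, RCLike.norm_conj, Complex.norm_real, norm_inv,
        inv_pow, norm_eq_abs, sq_abs, hss, ← hS]
      rw [inv_mul_cancel₀ h0.ne'])
  have h2 : ∑ k ∈ range N, ((√S)⁻¹ : ℝ) * starRingEnd ℂ (fourierCoeff f (m k)) *
      fourierCoeff f (m k) = ((√S : ℝ) : ℂ) := by
    simp only [mul_assoc, ← mul_sum, Complex.conj_mul']
    have h4 : (√S)⁻¹ * S = √S := by
      rw [inv_mul_eq_iff_eq_mul₀ hs.ne', ← sq, hss]
    rw [← Complex.ofReal_inj, Complex.ofReal_mul, hS, Complex.ofReal_sum, ← hS] at h4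
    simpa using h4
  rw [h2, ← ofReal_norm, Complex.norm_real, norm_of_nonneg hs.le] at h
  have h3 : √S ≤ B.toReal := (ENNReal.ofReal_le_iff_le_toReal hB).mp h
  rw [← hss]
  gcongr

end DyadicBlockMaxima

/-- For every measurable `f : 𝕋 → ℂ` with `∫ |f| log^{1/2}(1+|f|) < ∞`, the sums of the maxima
of `|f̂(n)|²` over the dyadic blocks `I_k = [2^k - 1, 2^{k+1} - 2] ∩ ℕ₀` is finite. -/
theorem summable_dyadic_block_maxima
    (f : AddCircle (1 : ℝ) → ℂ)
    (hmeas : AEStronglyMeasurable f AddCircle.haarAddCircle)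
    (hf : ∫⁻ θ, (‖f θ‖₊ : ℝ≥0∞) *
        ENNReal.ofReal (Real.log (1 + ‖f θ‖) ^ ((1 : ℝ) / 2)) ∂AddCircle.haarAddCircle ≠ ∞) :
    Summable fun k : ℕ =>
      (((Finset.Icc ((2 : ℤ) ^ k - 1) ((2 : ℤ) ^ (k + 1) - 2)).sup
        fun n => ‖fourierCoeff f n‖₊ ^ 2 : ℝ≥0) : ℝ) := by
  have hne : ∀ k : ℕ, (Finset.Icc ((2 : ℤ) ^ k - 1) ((2 : ℤ) ^ (k + 1) - 2)).Nonempty := by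
    intro k
    have : (1 : ℤ) ≤ 2 ^ k := one_le_pow₀ (by norm_num)
    rw [Finset.nonempty_Icc, pow_succ]
    linarith
  choose n hn hsup using fun k => Finset.exists_mem_eq_sup _ (hne k)
    fun n => ‖fourierCoeff f n‖₊ ^ 2
  simp only [hsup, Finset.mem_Icc] at hn ⊢
  push_cast
  have lacunary : ∀ i : ℕ, 1 ≤ i → Summable fun j => ‖fourierCoeff f (n (2 * j + i))‖ ^ 2 := by
    intro i hi
    have hi2 : (2 : ℤ) ≤ 2 ^ i := by simpa using pow_le_pow_right₀ (one_le_two (α := ℤ)) hi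
    have lower : ∀ j, (4 : ℤ) ^ j * 2 ^ i - 1 ≤ n (2 * j + i) := fun j => by
      have := (hn (2 * j + i)).1
      rwa [pow_add, pow_mul, show (2 : ℤ) ^ 2 = 4 by norm_num] at this
    have upper : ∀ j, n (2 * j + i) ≤ 2 * ((4 : ℤ) ^ j * 2 ^ i) - 2 := fun j => by
      have := (hn (2 * j + i)).2
      rw [pow_succ, pow_add, pow_mul, show (2 : ℤ) ^ 2 = 4 by norm_num] at this
      linarith
    have hone : ∀ j : ℕ, (1 : ℤ) ≤ 4 ^ j := fun j => one_le_pow₀ (by norm_num)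
    refine DyadicBlockMaxima.summable_sq_fourierCoeff_of_lacunary hmeas hf (fun j => ?_) fun N => ?_
    · nlinarith [lower j, hone j]
    · have hsum : ∑ j ∈ Finset.range N, n (2 * j + i) ≤ 4 ^ N * 2 ^ i - 2 := by
        induction N with
        | zero => simpa using hi2
        | succ N ih =>
          rw [Finset.sum_range_succ, pow_succ]
          nlinarith [upper N, hone N]
      linarith [lower N]
  refine (summable_nat_add_iff (f := fun k => ‖fourierCoeff f (n k)‖ ^ 2) 1).mp ?_
  exact Summable.even_add_odd (lacunary 1 le_rfl) (lacunary 2 one_le_two)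
end

section
/- For every real number r with 0 ≤ r < 1/2, there is no constant C > 0 such that for every trigonometric polynomial f on 𝕋 one has ( ∑_{n ≥ 1} |f̂(n)|² / n )^{1/2} ≤ C · ( 1 + ∫_𝕋 |f(θ)| log^{r}(1 + |f(θ)|) dθ ). -/
open MeasureTheory ENNReal NNReal

/-- Fourier coefficients of a finite linear combination of characters. -/
theorem fourierCoeff_sum_fourier {T : ℝ} [Fact (0 < T)] {ι : Type*} (s : Finset ι) (a : ι → ℂ)
    (g : ι → ℤ) (n : ℤ) :
    fourierCoeff (fun t : AddCircle T => ∑ i ∈ s, a i * fourier (g i) t) n =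
      ∑ i ∈ s with g i = n, a i := by
  have h := congrFun (fourierCoeff.sum s (fun i (t : AddCircle T) => a i * fourier (g i) t)
    fun i _ => Continuous.integrable_of_hasCompactSupport (by fun_prop) (.of_compactSpace _)) n
  simp only [Finset.sum_apply, fourierCoeff.const_mul, fourierCoeff_fourier, Pi.single_apply,
    mul_ite, mul_one, mul_zero] at h
  rw [Finset.sum_filter]
  convert! h using 2
  · ext t; simp
  · simp [eq_comm]

/-- A finite linear combination of characters, possibly with repetitions, is a trigonometric
polynomial. -/
theorem exists_trigPolynomial_eq_sum {T : ℝ} {ι : Type*} (s : Finset ι) (a : ι → ℂ) (g : ι → ℤ) :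
    ∃ (F : Finset ℤ) (c : ℤ → ℂ), (fun t : AddCircle T => ∑ i ∈ s, a i * fourier (g i) t) =
      fun t => ∑ n ∈ F, c n * fourier n t := by
  refine ⟨s.image g, fun n => ∑ i ∈ s with g i = n, a i, funext fun t => ?_⟩
  rw [← Finset.sum_fiberwise_of_maps_to (t := s.image g) (g := g)
    fun i hi => Finset.mem_image_of_mem g hi]
  refine Finset.sum_congr rfl fun n _ => ?_
  rw [Finset.sum_mul]
  exact Finset.sum_congr rfl fun i hi => by rw [(Finset.mem_filter.mp hi).2]

/-- The Fejér kernel `N⁻¹ ∑_{j,k < N} e^{2πi(j-k)θ}`. -/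
noncomputable def fejerKernel (N : ℕ) (θ : AddCircle (1 : ℝ)) : ℂ :=
  ∑ p ∈ Finset.range N ×ˢ Finset.range N, (N : ℂ)⁻¹ * fourier ((p.1 : ℤ) - p.2) θ

theorem fejerKernel_eq_norm_sq (N : ℕ) (θ : AddCircle (1 : ℝ)) :
    fejerKernel N θ =
      (((N : ℝ)⁻¹ * ‖∑ k ∈ Finset.range N, fourier (k : ℤ) θ‖ ^ 2 : ℝ) : ℂ) := by
  rw [fejerKernel, ← Finset.mul_sum]
  push_cast
  rw [← Complex.mul_conj', map_sum, Finset.sum_mul_sum, ← Finset.sum_product']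
  congr 1
  refine Finset.sum_congr rfl fun p _ => ?_
  rw [sub_eq_add_neg, fourier_add, fourier_neg]

theorem fejerKernel_eq_norm (N : ℕ) (θ : AddCircle (1 : ℝ)) :
    fejerKernel N θ = (‖fejerKernel N θ‖ : ℂ) := by
  rw [fejerKernel_eq_norm_sq, Complex.norm_of_nonneg (by positivity)]

theorem norm_fejerKernel_le (N : ℕ) (θ : AddCircle (1 : ℝ)) : ‖fejerKernel N θ‖ ≤ N := by
  rw [fejerKernel]
  refine (norm_sum_le _ _).trans ?_
  have (k : ℤ) : ‖fourier k θ‖ = 1 := Circle.norm_coe _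
  simp only [norm_mul, this, norm_inv, Complex.norm_natCast, Finset.sum_const,
    Finset.card_product, Finset.card_range, nsmul_eq_mul, Nat.cast_mul, mul_one]
  rcases eq_or_ne N 0 with rfl | h
  · simp
  · field_simp
    rfl

theorem fourierCoeff_fejerKernel (N : ℕ) (n : ℤ) :
    fourierCoeff (fejerKernel N) n =
      (({p ∈ Finset.range N ×ˢ Finset.range N | (p.1 : ℤ) - p.2 = n}.card / N : ℝ) : ℂ) := by
  unfold fejerKernel
  rw [fourierCoeff_sum_fourier]
  simp [div_eq_mul_inv]

theorem lintegral_enorm_fejerKernel_le (N : ℕ) :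
    ∫⁻ θ, (‖fejerKernel N θ‖₊ : ℝ≥0∞) ∂AddCircle.haarAddCircle ≤ 1 := by
  have hc : Continuous (fejerKernel N) := by unfold fejerKernel; fun_prop
  have hi : Integrable (fejerKernel N) AddCircle.haarAddCircle :=
    hc.integrable_of_hasCompactSupport (.of_compactSpace _)
  change ∫⁻ θ, ‖fejerKernel N θ‖ₑ ∂AddCircle.haarAddCircle ≤ 1
  rw [← ofReal_integral_norm_eq_lintegral_enorm hi, ENNReal.ofReal_le_one]
  have h : ((∫ θ, ‖fejerKernel N θ‖ ∂AddCircle.haarAddCircle : ℝ) : ℂ) =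
      fourierCoeff (fejerKernel N) 0 := by
    rw [← integral_complex_ofReal]
    simp [fourierCoeff, ← fejerKernel_eq_norm]
  rw [fourierCoeff_fejerKernel, Complex.ofReal_inj] at h
  rw [h]
  refine div_le_one_of_le₀ ?_ N.cast_nonneg
  have : {p ∈ Finset.range N ×ˢ Finset.range N | (p.1 : ℤ) - p.2 = 0} ⊆
      (Finset.range N).image fun k => (k, k) := by
    intro p hp
    simp only [Finset.mem_filter, Finset.mem_product, Finset.mem_range] at hp
    exact Finset.mem_image.mpr ⟨p.1, by simp [hp.1.1], Prod.ext rfl (by simp; omega)⟩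
  exact_mod_cast (Finset.card_le_card this).trans (Finset.card_image_le.trans (by simp))

theorem half_le_norm_fourierCoeff_fejerKernel {M n : ℕ} (h : n < M) :
    1 / 2 ≤ ‖fourierCoeff (fejerKernel (2 * M)) ((n : ℤ) + 1)‖ := by
  rw [fourierCoeff_fejerKernel, Complex.norm_of_nonneg (by positivity)]
  have hsub : (Finset.range M).image (fun k => (k + (n + 1), k)) ⊆
      {p ∈ Finset.range (2 * M) ×ˢ Finset.range (2 * M) | (p.1 : ℤ) - p.2 = n + 1} := by
    intro p hp
    obtain ⟨k, hk, rfl⟩ := Finset.mem_image.mp hp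
    simp only [Finset.mem_filter, Finset.mem_product, Finset.mem_range] at hk ⊢
    push_cast
    omega
  have hcard := Finset.card_le_card hsub
  rw [Finset.card_image_of_injective _ fun a b hab => (Prod.ext_iff.mp hab).2,
    Finset.card_range] at hcard
  have hM : (0 : ℝ) < M := by exact_mod_cast (Nat.zero_le n).trans_lt h
  have hcard' : (M : ℝ) ≤ _ := Nat.cast_le.mpr hcard
  push_cast
  rw [div_le_div_iff₀ two_pos (by positivity)]
  linarith

theorem log_le_tsum_fourierCoeff_fejerKernel (M : ℕ) :
    ENNReal.ofReal (Real.log (M + 1) / 4) ≤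
      ∑' n : ℕ, (‖fourierCoeff (fejerKernel (2 * M)) ((n : ℤ) + 1)‖₊ : ℝ≥0∞) ^ 2 /
        ((n : ℝ≥0∞) + 1) := by
  calc ENNReal.ofReal (Real.log (M + 1) / 4)
      ≤ ENNReal.ofReal (∑ n ∈ Finset.range M, (1 / 2) ^ 2 / ((n : ℝ) + 1)) := by
        refine ENNReal.ofReal_le_ofReal ?_
        have h := log_add_one_le_harmonic M
        simp only [harmonic] at h
        push_cast at h
        simp only [div_eq_mul_inv _ ((_ : ℝ) + 1), ← Finset.mul_sum]
        linarith
    _ = ∑ n ∈ Finset.range M, ENNReal.ofReal ((1 / 2) ^ 2 / ((n : ℝ) + 1)) :=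
        ENNReal.ofReal_sum_of_nonneg fun n _ => by positivity
    _ ≤ ∑ n ∈ Finset.range M,
          (‖fourierCoeff (fejerKernel (2 * M)) ((n : ℤ) + 1)‖₊ : ℝ≥0∞) ^ 2 / ((n : ℝ≥0∞) + 1) := by
        refine Finset.sum_le_sum fun n hn => ?_
        have h := half_le_norm_fourierCoeff_fejerKernel (Finset.mem_range.mp hn)
        rw [ENNReal.ofReal_div_of_pos (by positivity), ENNReal.ofReal_pow (by norm_num),
          ENNReal.ofReal_add n.cast_nonneg zero_le_one, ENNReal.ofReal_natCast, ENNReal.ofReal_one]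
        gcongr
        rw [← enorm_eq_nnnorm, ← ofReal_norm]
        exact ENNReal.ofReal_le_ofReal h
    _ ≤ _ := ENNReal.sum_le_tsum _

theorem lintegral_fejerKernel_mul_log_le {r : ℝ} (hr : 0 ≤ r) (N : ℕ) :
    ∫⁻ θ, (‖fejerKernel N θ‖₊ : ℝ≥0∞) *
        ENNReal.ofReal (Real.log (1 + ‖fejerKernel N θ‖) ^ r) ∂AddCircle.haarAddCircle ≤
      ENNReal.ofReal (Real.log (1 + N) ^ r) := by
  calc _ ≤ ∫⁻ θ, (‖fejerKernel N θ‖₊ : ℝ≥0∞) * ENNReal.ofReal (Real.log (1 + N) ^ r)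
          ∂AddCircle.haarAddCircle := by
        refine lintegral_mono fun θ => ?_
        have h := norm_fejerKernel_le N θ
        have h0 : 0 ≤ Real.log (1 + ‖fejerKernel N θ‖) :=
          Real.log_nonneg (by linarith [norm_nonneg (fejerKernel N θ)])
        dsimp only
        gcongr
    _ = (∫⁻ θ, (‖fejerKernel N θ‖₊ : ℝ≥0∞) ∂AddCircle.haarAddCircle) *
          ENNReal.ofReal (Real.log (1 + N) ^ r) :=
        lintegral_mul_const' _ _ ENNReal.ofReal_ne_top
    _ ≤ _ := mul_le_of_le_one_left' (lintegral_enorm_fejerKernel_le N)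

open Filter in
/-- For `r < 1/2`, `C (1 + y ^ r)` is eventually smaller than `(y / 8) ^ (1/2)`. -/
theorem eventually_mul_one_add_rpow_lt {r : ℝ} (hr0 : 0 ≤ r) (hr : r < 1 / 2) (C : ℝ)
    (hC : 0 < C) :
    ∀ᶠ y : ℝ in atTop, C * (1 + y ^ r) < (y / 8) ^ ((1 : ℝ) / 2) := by
  filter_upwards [(_root_.tendsto_rpow_atTop (sub_pos.mpr hr)).eventually_gt_atTop
    (2 * C * 8 ^ ((1 : ℝ) / 2)), eventually_ge_atTop 1] with y hy hy1
  have hy0 : 0 < y := by linarith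
  have h1 : 1 ≤ y ^ r := Real.one_le_rpow hy1 hr0
  rw [Real.div_rpow hy0.le (by norm_num), lt_div_iff₀ (by positivity)]
  calc C * (1 + y ^ r) * 8 ^ ((1 : ℝ) / 2)
      ≤ C * (y ^ r + y ^ r) * 8 ^ ((1 : ℝ) / 2) := by gcongr
    _ = 2 * C * 8 ^ ((1 : ℝ) / 2) * y ^ r := by ring
    _ < y ^ (1 / 2 - r) * y ^ r := by gcongr
    _ = y ^ ((1 : ℝ) / 2) := by rw [← Real.rpow_add hy0, sub_add_cancel]

/-- **Sharpness of the exponent 1/2.** For every `0 ≤ r < 1/2` there is no constant `C > 0`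
such that every trigonometric polynomial `f` on `𝕋` satisfies
`(∑_{n ≥ 1} |f̂ n|²/n)^{1/2} ≤ C (1 + ∫ |f| log^r(1+|f|))`. -/
theorem sharpness_of_half_exponent (r : ℝ) (hr0 : 0 ≤ r) (hr : r < 1 / 2) :
    ¬ ∃ C : ℝ, 0 < C ∧
      ∀ f : AddCircle (1 : ℝ) → ℂ,
        (∃ (F : Finset ℤ) (c : ℤ → ℂ), f = fun θ => ∑ n ∈ F, c n * fourier n θ) →
        (∑' n : ℕ, (‖fourierCoeff f ((n : ℤ) + 1)‖₊ : ℝ≥0∞) ^ 2 / ((n : ℝ≥0∞) + 1)) ^ ((1 : ℝ) / 2)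
          ≤ ENNReal.ofReal C *
            (1 + ∫⁻ θ, (‖f θ‖₊ : ℝ≥0∞) *
              ENNReal.ofReal (Real.log (1 + ‖f θ‖) ^ r) ∂AddCircle.haarAddCircle) := by
  rintro ⟨C, hC, h⟩
  have hlim : Filter.Tendsto (fun M : ℕ => 2 * Real.log ((M : ℝ) + 1)) .atTop .atTop :=
    (Real.tendsto_log_atTop.comp
      (tendsto_natCast_atTop_atTop.atTop_add tendsto_const_nhds)).const_mul_atTop two_pos
  obtain ⟨M, hM⟩ := (hlim.eventually (eventually_mul_one_add_rpow_lt hr0 hr C hC)).exists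
  refine hM.not_ge ?_
  have hL : 0 ≤ Real.log ((M : ℝ) + 1) := Real.log_nonneg (by simp)
  have hlog : Real.log (1 + (2 * M : ℕ)) ≤ 2 * Real.log ((M : ℝ) + 1) := by
    rw [← Real.log_rpow (by positivity)]
    refine Real.log_le_log (by positivity) ?_
    push_cast
    norm_num
    nlinarith [sq_nonneg (M : ℝ)]
  have key := h (fejerKernel (2 * M)) (exists_trigPolynomial_eq_sum _ _ _)
  have hlow := ENNReal.rpow_le_rpow (log_le_tsum_fourierCoeff_fejerKernel M)
    (by norm_num : (0 : ℝ) ≤ 1 / 2)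
  rw [ENNReal.ofReal_rpow_of_nonneg (by positivity) (by norm_num)] at hlow
  have hup : ENNReal.ofReal C * (1 + ENNReal.ofReal (Real.log (1 + (2 * M : ℕ)) ^ r)) ≤
      ENNReal.ofReal (C * (1 + (2 * Real.log ((M : ℝ) + 1)) ^ r)) := by
    rw [ENNReal.ofReal_mul hC.le, ENNReal.ofReal_add zero_le_one (by positivity),
      ENNReal.ofReal_one]
    have : 0 ≤ Real.log (1 + (2 * M : ℕ)) := Real.log_nonneg (by simp)
    gcongr
  have hfin := (hlow.trans key).trans <|
    (mul_le_mul_right (add_le_add_right (lintegral_fejerKernel_mul_log_le hr0 _) _) _).trans hup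
  rw [ENNReal.ofReal_le_ofReal_iff (by positivity)] at hfin
  convert! hfin using 2
  ring
end

section
/- There exist absolute constants A > 0 and B > 0 such that for every integrable function f : 𝕋 → ℂ, ( ∑_{n ∈ ℤ, n ≠ 0} |f̂(n)|² / |n| )^{1/2} ≤ A ∫_𝕋 |f(θ)| log^{1/2}(1 + |f(θ)|) dθ + B. -/
open MeasureTheory ENNReal NNReal

theorem ENNReal.add_sq_le_two_mul (a b : ℝ≥0∞) : (a + b) ^ 2 ≤ 2 * (a ^ 2 + b ^ 2) := by
  have h := ENNReal.rpow_add_le_mul_rpow_add_rpow a b (p := 2) (by norm_num)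
  norm_num at h
  exact_mod_cast h

theorem sum_ite_two_pow_lt_le_log {w : ℝ} (hw : 0 ≤ w) (J : ℕ) :
    ∑ j ∈ Finset.range J, (if (2 : ℝ) ^ j < w then (1 : ℝ) else 0) ≤ 3 * Real.log (1 + w) := by
  induction J with
  | zero => simpa using Real.log_nonneg (by linarith)
  | succ J ih =>
    by_cases h : (2 : ℝ) ^ J < w
    · have hcard : ∑ j ∈ Finset.range (J + 1), (if (2 : ℝ) ^ j < w then (1 : ℝ) else 0)
          ≤ (J + 1 : ℕ) := by
        simpa using Finset.sum_le_card_nsmul (Finset.range (J + 1))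
          (fun j => if (2 : ℝ) ^ j < w then (1 : ℝ) else 0) 1
          (fun j _ => by split_ifs <;> norm_num)
      have h1 : (1 : ℝ) ≤ 2 ^ J := one_le_pow₀ (by norm_num)
      have h2 : J * Real.log 2 ≤ Real.log (1 + w) := by
        rw [← Real.log_pow]
        exact Real.log_le_log (by positivity) (by linarith)
      have h3 : Real.log 2 ≤ Real.log (1 + w) := Real.log_le_log (by norm_num) (by linarith)
      have h4 := Real.log_two_gt_d9
      have h5 : (J : ℝ) * (2 / 3) ≤ J * Real.log 2 := by gcongr; linarith
      push_cast at hcard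
      linarith
    · rwa [Finset.sum_range_succ, if_neg h, add_zero]

theorem sum_ite_two_pow_lt_mul_le {u v : ℝ} (hu : 0 ≤ u) (hv : 0 ≤ v) (J : ℕ) :
    ∑ j ∈ Finset.range J, ((if (2 : ℝ) ^ j < u then (1 : ℝ≥0∞) else 0) *
        (if (2 : ℝ) ^ j < v then 1 else 0)) ≤
      3 * (ENNReal.ofReal (Real.log (1 + u) ^ ((1 : ℝ) / 2)) *
        ENNReal.ofReal (Real.log (1 + v) ^ ((1 : ℝ) / 2))) := by
  set w := min u v with hw
  have hw0 : 0 ≤ w := le_min hu hv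
  have hL : 0 ≤ Real.log (1 + w) := Real.log_nonneg (by linarith)
  calc _ = ENNReal.ofReal (∑ j ∈ Finset.range J, (if (2 : ℝ) ^ j < w then (1 : ℝ) else 0)) := by
        rw [ENNReal.ofReal_sum_of_nonneg (fun j _ => by split_ifs <;> norm_num)]
        refine Finset.sum_congr rfl fun j _ => ?_
        by_cases h1 : (2 : ℝ) ^ j < u <;> by_cases h2 : (2 : ℝ) ^ j < v <;> simp [hw, h1, h2]
    _ ≤ ENNReal.ofReal (3 * Real.log (1 + w)) :=
        ENNReal.ofReal_le_ofReal (sum_ite_two_pow_lt_le_log hw0 J)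
    _ = 3 * (ENNReal.ofReal (Real.log (1 + w) ^ ((1 : ℝ) / 2)) *
        ENNReal.ofReal (Real.log (1 + w) ^ ((1 : ℝ) / 2))) := by
        rw [← ENNReal.ofReal_mul (by positivity), ← Real.sqrt_eq_rpow, Real.mul_self_sqrt hL,
          ENNReal.ofReal_mul (by norm_num), ENNReal.ofReal_ofNat]
    _ ≤ _ := by
        gcongr
        · exact min_le_left _ _
        · exact min_le_right _ _

theorem tsum_sq_lintegral_tail_le {α E : Type*} [MeasurableSpace α] [NormedAddCommGroup E]
    {μ : Measure α} {f : α → E} (hf : StronglyMeasurable f) :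
    ∑' j : ℕ, (∫⁻ x, {x | (2 : ℝ) ^ j < ‖f x‖}.indicator (fun x => ‖f x‖ₑ) x ∂μ) ^ 2 ≤
      3 * (∫⁻ x, ‖f x‖ₑ * ENNReal.ofReal (Real.log (1 + ‖f x‖) ^ ((1 : ℝ) / 2)) ∂μ) ^ 2 := by
  set g : ℕ → α → ℝ≥0∞ := fun j => {x | (2 : ℝ) ^ j < ‖f x‖}.indicator (fun x => ‖f x‖ₑ) with hg
  set h : α → ℝ≥0∞ := fun x => ‖f x‖ₑ * ENNReal.ofReal (Real.log (1 + ‖f x‖) ^ ((1 : ℝ) / 2))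
    with hh
  have hfn : Measurable fun x => ‖f x‖ := hf.norm.measurable
  have hgm (j) : Measurable (g j) := hf.enorm.indicator (measurableSet_lt measurable_const hfn)
  have hhm : Measurable h := hf.enorm.mul (by fun_prop)
  have hsq {k : α → ℝ≥0∞} (hk : Measurable k) :
      (∫⁻ x, k x ∂μ) ^ 2 = ∫⁻ x, ∫⁻ y, k x * k y ∂μ ∂μ := by
    simp_rw [lintegral_const_mul _ hk]
    rw [lintegral_mul_const _ hk, sq]
  refine ENNReal.tsum_le_of_sum_range_le fun J => ?_
  calc ∑ j ∈ Finset.range J, (∫⁻ x, g j x ∂μ) ^ 2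
      = ∫⁻ x, ∫⁻ y, ∑ j ∈ Finset.range J, g j x * g j y ∂μ ∂μ := by
        simp_rw [hsq (hgm _)]
        rw [← lintegral_finsetSum]
        · refine lintegral_congr fun x => (lintegral_finsetSum _ fun j _ => ?_).symm
          exact (hgm j).const_mul _
        · intro j _
          simp_rw [lintegral_const_mul _ (hgm j)]
          exact (hgm j).mul_const _
    _ ≤ ∫⁻ x, ∫⁻ y, 3 * (h x * h y) ∂μ ∂μ := by
        refine lintegral_mono fun x => lintegral_mono fun y => ?_
        calc ∑ j ∈ Finset.range J, g j x * g j y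
            = ‖f x‖ₑ * ‖f y‖ₑ * ∑ j ∈ Finset.range J,
              ((if (2 : ℝ) ^ j < ‖f x‖ then (1 : ℝ≥0∞) else 0) *
                (if (2 : ℝ) ^ j < ‖f y‖ then 1 else 0)) := by
              rw [Finset.mul_sum]
              refine Finset.sum_congr rfl fun j _ => ?_
              simp only [hg, Set.indicator_apply, Set.mem_ofPred_eq]
              split_ifs <;> simp
          _ ≤ _ := by
              refine (mul_le_mul_right (sum_ite_two_pow_lt_mul_le (norm_nonneg _) (norm_nonneg _) J)
                _).trans_eq ?_
              simp only [hh]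
              ring
    _ = 3 * (∫⁻ x, h x ∂μ) ^ 2 := by
        rw [hsq hhm, ← lintegral_const_mul]
        · refine lintegral_congr fun x => lintegral_const_mul _ (hhm.const_mul _)
        · simp_rw [lintegral_const_mul _ hhm]
          exact hhm.mul_const _

section Fourier

variable {T : ℝ} [Fact (0 < T)]

theorem tsum_enorm_sq_fourierCoeff_le_of_norm_le {f : AddCircle T → ℂ}
    (hf : AEStronglyMeasurable f AddCircle.haarAddCircle) {C : ℝ} (hC : ∀ x, ‖f x‖ ≤ C) :
    ∑' n : ℤ, ‖fourierCoeff f n‖ₑ ^ 2 ≤ ENNReal.ofReal (C ^ 2) := by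
  have hmem : MemLp f 2 AddCircle.haarAddCircle := .of_bound hf C (.of_forall hC)
  have hsum := hasSum_sq_fourierCoeff hmem.toLp
  rw [fourierCoeff_congr_ae hmem.coeFn_toLp] at hsum
  have hnorm (n : ℤ) : ‖fourierCoeff f n‖ₑ ^ 2 = ENNReal.ofReal (‖fourierCoeff f n‖ ^ 2) := by
    rw [ENNReal.ofReal_pow (norm_nonneg _), ofReal_norm]
  simp_rw [hnorm]
  rw [← ENNReal.ofReal_tsum_of_nonneg (fun _ => by positivity) hsum.summable, hsum.tsum_eq]
  refine ENNReal.ofReal_le_ofReal ?_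
  calc _ ≤ ∫ _ : AddCircle T, C ^ 2 ∂AddCircle.haarAddCircle := by
        refine integral_mono_of_nonneg (.of_forall fun _ => by positivity) (integrable_const _) ?_
        filter_upwards [hmem.coeFn_toLp] with x hx
        rw [hx]
        have := hC x
        gcongr
    _ = C ^ 2 := by simp

theorem enorm_fourierCoeff_le_lintegral (f : AddCircle T → ℂ) (n : ℤ) :
    ‖fourierCoeff f n‖ₑ ≤ ∫⁻ x, ‖f x‖ₑ ∂AddCircle.haarAddCircle := by
  refine (enorm_integral_le_lintegral_enorm _).trans_eq (lintegral_congr fun x => ?_)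
  rw [enorm_smul, ← ofReal_norm (fourier (-n) x), fourier_apply, Circle.norm_coe]
  simp

theorem enorm_fourierCoeff_le_truncation_add_tail {f : AddCircle T → ℂ} (hm : StronglyMeasurable f)
    (hf : Integrable f AddCircle.haarAddCircle) (R : ℝ) (n : ℤ) :
    ‖fourierCoeff f n‖ₑ ≤ ‖fourierCoeff ({x | ‖f x‖ ≤ R}.indicator f) n‖ₑ +
      ∫⁻ x, {x | R < ‖f x‖}.indicator (fun x => ‖f x‖ₑ) x ∂AddCircle.haarAddCircle := by
  have hS : MeasurableSet {x | ‖f x‖ ≤ R} := measurableSet_le hm.norm.measurable measurable_const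
  have hcompl : {x | ‖f x‖ ≤ R}ᶜ = {x | R < ‖f x‖} := by ext; simp
  have hadd := fourierCoeff.add (hf.indicator hS) (hf.indicator hS.compl)
  rw [Set.indicator_self_add_compl, hcompl] at hadd
  rw [hadd, Pi.add_apply]
  refine (enorm_add_le _ _).trans (add_le_add_right ?_ _)
  refine (enorm_fourierCoeff_le_lintegral _ n).trans_eq (lintegral_congr fun x => ?_)
  exact enorm_indicator_eq_indicator_enorm f x

end Fourier

theorem tsum_ite_natLog_natAbs_eq_le (j : ℕ) :
    ∑' n : ℤ, (if Nat.log 8 n.natAbs = j then (1 : ℝ≥0∞) else 0) ≤ 16 * 8 ^ j := by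
  have hlt {n : ℤ} (h : Nat.log 8 n.natAbs = j) :
      n ∈ Finset.Ioo (-(8 ^ (j + 1) : ℤ)) (8 ^ (j + 1)) := by
    have := Nat.lt_pow_succ_log_self (b := 8) (by norm_num) n.natAbs
    rw [h] at this
    zify at this
    rw [Finset.mem_Ioo, ← abs_lt]
    exact this
  rw [tsum_eq_sum (s := Finset.Ioo (-(8 ^ (j + 1) : ℤ)) (8 ^ (j + 1)))
    (fun n hn => if_neg fun h => hn (hlt h))]
  calc _ ≤ ∑ n ∈ Finset.Ioo (-(8 ^ (j + 1) : ℤ)) (8 ^ (j + 1)), (1 : ℝ≥0∞) :=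
        Finset.sum_le_sum fun n _ => by split_ifs <;> simp
    _ ≤ 16 * 8 ^ j := by
        rw [Finset.sum_const, nsmul_one, Int.card_Ioo]
        have : (8 ^ (j + 1) - -8 ^ (j + 1) - 1 : ℤ).toNat ≤ 16 * 8 ^ j := by
          rw [Int.toNat_le]
          push_cast
          rw [pow_succ]
          linarith
        exact_mod_cast this

theorem tsum_div_natAbs_le_tsum_blocks (t : ℤ → ℝ≥0∞) :
    ∑' n : {n : ℤ // n ≠ 0}, t n / ((n : ℤ).natAbs : ℝ≥0∞) ≤
      ∑' j : ℕ, ∑' n : ℤ, if Nat.log 8 n.natAbs = j then t n / 8 ^ j else 0 := by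
  rw [ENNReal.tsum_comm]
  calc ∑' n : {n : ℤ // n ≠ 0}, t n / ((n : ℤ).natAbs : ℝ≥0∞)
      ≤ ∑' n : {n : ℤ // n ≠ 0}, t n / 8 ^ Nat.log 8 (n : ℤ).natAbs := by
        refine ENNReal.tsum_le_tsum fun n => ENNReal.div_le_div_left ?_ _
        exact_mod_cast Nat.pow_log_le_self 8 (Int.natAbs_ne_zero.mpr n.2)
    _ ≤ ∑' n : ℤ, t n / 8 ^ Nat.log 8 n.natAbs :=
        ENNReal.tsum_comp_le_tsum_of_injective Subtype.val_injective _
    _ = _ := tsum_congr fun n => by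
        rw [tsum_eq_single (Nat.log 8 n.natAbs) fun j hj => if_neg hj.symm, if_pos rfl]

theorem tsum_four_pow_div_eight_pow : ∑' j : ℕ, (4 : ℝ≥0∞) ^ j / 8 ^ j = 2 := by
  have h (j : ℕ) : (4 : ℝ≥0∞) ^ j / 8 ^ j = 2⁻¹ ^ j := by
    rw [div_eq_mul_inv, ENNReal.inv_pow (a := 8), ← mul_pow]
    congr 1
    rw [show (8 : ℝ≥0∞) = 4 * 2 by norm_num, ENNReal.mul_inv (by simp) (by simp), ← mul_assoc,
      ENNReal.mul_inv_cancel (by simp) (by simp), one_mul]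
  simp_rw [h]
  rw [ENNReal.tsum_geometric, ENNReal.one_sub_inv_two, inv_inv]

theorem tsum_enorm_sq_fourierCoeff_div_natAbs_le {T : ℝ} [Fact (0 < T)] {f : AddCircle T → ℂ}
    (hm : StronglyMeasurable f) (hf : Integrable f AddCircle.haarAddCircle) :
    ∑' n : {n : ℤ // n ≠ 0}, ‖fourierCoeff f n‖ₑ ^ 2 / ((n : ℤ).natAbs : ℝ≥0∞) ≤
      4 + 96 * (∫⁻ x, ‖f x‖ₑ * ENNReal.ofReal (Real.log (1 + ‖f x‖) ^ ((1 : ℝ) / 2))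
        ∂AddCircle.haarAddCircle) ^ 2 := by
  set c : ℕ → ℤ → ℝ≥0∞ := fun j n => ‖fourierCoeff ({x | ‖f x‖ ≤ 2 ^ j}.indicator f) n‖ₑ
  set a : ℕ → ℝ≥0∞ := fun j =>
    ∫⁻ x, {x | (2 : ℝ) ^ j < ‖f x‖}.indicator (fun x => ‖f x‖ₑ) x ∂AddCircle.haarAddCircle
  have hc (j : ℕ) : ∑' n : ℤ, c j n ^ 2 ≤ 4 ^ j := by
    refine (tsum_enorm_sq_fourierCoeff_le_of_norm_le (C := 2 ^ j) ?_ fun x => ?_).trans_eq ?_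
    · exact (hm.indicator
        (measurableSet_le hm.norm.measurable measurable_const)).aestronglyMeasurable
    · rw [Set.indicator_apply]
      split_ifs with h
      · exact h
      · simp
    · rw [← pow_mul, mul_comm, pow_mul, ENNReal.ofReal_pow (by norm_num)]
      norm_num
  have hblock (j : ℕ) :
      ∑' n : ℤ, (if Nat.log 8 n.natAbs = j then ‖fourierCoeff f n‖ₑ ^ 2 / 8 ^ j else 0) ≤
        2 * (4 ^ j / 8 ^ j) + 32 * a j ^ 2 := by
    calc _ ≤ ∑' n : ℤ, (2 / 8 ^ j * c j n ^ 2 +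
          2 * a j ^ 2 / 8 ^ j * if Nat.log 8 n.natAbs = j then 1 else 0) := by
          refine ENNReal.tsum_le_tsum fun n => ?_
          split_ifs with h
          · calc ‖fourierCoeff f n‖ₑ ^ 2 / 8 ^ j ≤ 2 * (c j n ^ 2 + a j ^ 2) / 8 ^ j := by
                  gcongr
                  refine le_trans ?_ (ENNReal.add_sq_le_two_mul _ _)
                  gcongr
                  exact enorm_fourierCoeff_le_truncation_add_tail hm hf _ n
              _ = _ := by simp only [div_eq_mul_inv]; ring
          · exact zero_le
      _ = 2 / 8 ^ j * ∑' n : ℤ, c j n ^ 2 + 2 * a j ^ 2 / 8 ^ j *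
          ∑' n : ℤ, (if Nat.log 8 n.natAbs = j then 1 else 0) := by
          rw [ENNReal.tsum_add, ENNReal.tsum_mul_left, ENNReal.tsum_mul_left]
      _ ≤ 2 / 8 ^ j * 4 ^ j + 2 * a j ^ 2 / 8 ^ j * (16 * 8 ^ j) := by
          gcongr
          · exact hc j
          · exact tsum_ite_natLog_natAbs_eq_le j
      _ = 2 * (4 ^ j / 8 ^ j) + 32 * a j ^ 2 * ((8 ^ j)⁻¹ * 8 ^ j) := by
          simp only [div_eq_mul_inv]; ring
      _ = _ := by rw [ENNReal.inv_mul_cancel (by simp) (by simp), mul_one]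
  calc _ ≤ ∑' j : ℕ, (2 * (4 ^ j / 8 ^ j) + 32 * a j ^ 2) :=
        (tsum_div_natAbs_le_tsum_blocks _).trans (ENNReal.tsum_le_tsum hblock)
    _ = 2 * 2 + 32 * ∑' j : ℕ, a j ^ 2 := by
        rw [ENNReal.tsum_add, ENNReal.tsum_mul_left, ENNReal.tsum_mul_left,
          tsum_four_pow_div_eight_pow]
    _ ≤ 2 * 2 + 32 * (3 * _) := by
        gcongr
        exact tsum_sq_lintegral_tail_le hm
    _ = _ := by ring

/-- There are absolute constants `A, B > 0` such that for every integrable `f : 𝕋 → ℂ`,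
`(∑_{n ≠ 0} |f̂ n|²/|n|)^{1/2} ≤ A ∫ |f| log^{1/2}(1+|f|) + B`
(stated in `ℝ≥0∞`, hence vacuous when the right-hand side integral is infinite). -/
theorem zygmund_inequality_for_reciprocal_sqrt_weight :
    ∃ A B : ℝ, 0 < A ∧ 0 < B ∧
      ∀ f : AddCircle (1 : ℝ) → ℂ, Integrable f AddCircle.haarAddCircle →
        (∑' n : {n : ℤ // n ≠ 0},
            (‖fourierCoeff f (n : ℤ)‖₊ : ℝ≥0∞) ^ 2 / ((n : ℤ).natAbs : ℝ≥0∞)) ^ ((1 : ℝ) / 2)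
          ≤ ENNReal.ofReal A *
              (∫⁻ θ, (‖f θ‖₊ : ℝ≥0∞) *
                ENNReal.ofReal (Real.log (1 + ‖f θ‖) ^ ((1 : ℝ) / 2)) ∂AddCircle.haarAddCircle)
            + ENNReal.ofReal B := by
  refine ⟨10, 2, by norm_num, by norm_num, fun f hf => ?_⟩
  have hae := hf.1.ae_eq_mk
  have key := tsum_enorm_sq_fourierCoeff_div_natAbs_le hf.1.stronglyMeasurable_mk (hf.congr hae)
  rw [← fourierCoeff_congr_ae hae, ← lintegral_congr_ae (hae.mono fun x hx => by
    show ‖f x‖ₑ * ENNReal.ofReal (Real.log (1 + ‖f x‖) ^ ((1 : ℝ) / 2)) = _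
    rw [hx])] at key
  simp only [← enorm_eq_nnnorm, ENNReal.ofReal_ofNat]
  rw [one_div] at key ⊢
  rw [ENNReal.rpow_inv_le_iff (by norm_num), ENNReal.rpow_ofNat]
  refine key.trans ?_
  set I := ∫⁻ x, ‖f x‖ₑ * ENNReal.ofReal (Real.log (1 + ‖f x‖) ^ (2⁻¹ : ℝ))
    ∂AddCircle.haarAddCircle
  calc 4 + 96 * I ^ 2 ≤ 4 + 96 * I ^ 2 + (4 * I ^ 2 + 40 * I) := le_self_add
    _ = (10 * I + 2) ^ 2 := by ring
end

section
/- The sequence m : ℤ → ℂ given by m(n) = 1/√|n| for n ≠ 0 and m(0) = 0 is not a Sidon weight on 𝕋: for every constant S > 0 there exists a trigonometric polynomial f on 𝕋 with f̂(0) = 0 such that ∑_{n ∈ ℤ, n ≠ 0} |f̂(n)| / √|n| > S · ‖f‖_{L^∞(𝕋)}. (In particular, there exist multipliers from L log^{1/2} L(𝕋) to L²(𝕋) which are not Sidon weights.) -/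
open MeasureTheory ENNReal NNReal

open LaurentPolynomial in
/-- All exponents occurring in the Laurent polynomial `p` lie in the interval `[a, b]`. -/
def LaurentPolynomial.SupportedIn (p : ℝ[T;T⁻¹]) (a b : ℤ) : Prop :=
  ∀ n, p.coeff n ≠ 0 → a ≤ n ∧ n ≤ b

namespace LaurentPolynomial

namespace SupportedIn

variable {p q : ℝ[T;T⁻¹]} {a b c d : ℤ}

lemma mono (hp : p.SupportedIn a b) (hc : c ≤ a) (hd : b ≤ d) : p.SupportedIn c d :=
  fun n hn => ⟨hc.trans (hp n hn).1, (hp n hn).2.trans hd⟩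

lemma add (hp : p.SupportedIn a b) (hq : q.SupportedIn a b) : (p + q).SupportedIn a b := by
  intro n hn
  by_cases h : p.coeff n = 0
  · exact hq n (by simpa [h] using hn)
  · exact hp n h

lemma sub (hp : p.SupportedIn a b) (hq : q.SupportedIn a b) : (p - q).SupportedIn a b := by
  intro n hn
  by_cases h : p.coeff n = 0
  · exact hq n (by simpa [h] using hn)
  · exact hp n h

lemma mul (hp : p.SupportedIn a b) (hq : q.SupportedIn c d) :
    (p * q).SupportedIn (a + c) (b + d) := by
  intro n hn
  obtain ⟨i, hi, j, hj, rfl⟩ := Finset.mem_add.1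
    (AddMonoidAlgebra.support_coeff_mul_subset p q (Finsupp.mem_support_iff.2 hn))
  have hi := hp i (Finsupp.mem_support_iff.1 hi)
  have hj := hq j (Finsupp.mem_support_iff.1 hj)
  omega

lemma const_mul (hp : p.SupportedIn a b) (r : ℝ) : (C r * p).SupportedIn a b := by
  intro n hn
  rw [← smul_eq_C_mul] at hn
  exact hp n fun h => hn (by simp [h])

lemma invert (hp : p.SupportedIn a b) : (LaurentPolynomial.invert p).SupportedIn (-b) (-a) := by
  intro n hn
  have := hp (-n) (by simpa using hn)
  omega

lemma T (n : ℤ) : (LaurentPolynomial.T n : ℝ[T;T⁻¹]).SupportedIn n n := by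
  intro m hm
  by_cases h : n = m
  · omega
  · simp [h] at hm

lemma coeff_eq_zero (hp : p.SupportedIn a b) {n : ℤ} (hn : n < a ∨ b < n) : p.coeff n = 0 := by
  by_contra h
  have := hp n h
  omega

end SupportedIn

lemma coeff_C_mul (r : ℝ) (p : ℝ[T;T⁻¹]) (n : ℤ) : (C r * p).coeff n = r * p.coeff n := by
  rw [← smul_eq_C_mul]; simp

lemma coeff_T_mul (m n : ℤ) (p : ℝ[T;T⁻¹]) : (T m * p).coeff n = p.coeff (n - m) := by
  rw [T, AddMonoidAlgebra.coeff_single_mul_eq_mul_coeff (n - m) (by intros; omega), one_mul]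

lemma T_mul_T_neg (n : ℤ) : (T n : ℝ[T;T⁻¹]) * T (-n) = 1 := by
  rw [← T_add]; simp

/-- Rudin–Shapiro pairs of Laurent polynomials. -/
lemma exists_rudin_shapiro (m : ℕ) : ∃ P Q : ℝ[T;T⁻¹],
    P.SupportedIn 0 (2 ^ m - 1) ∧ Q.SupportedIn 0 (2 ^ m - 1) ∧
    (∀ n, |P.coeff n| ≤ 1) ∧ (∀ n, |Q.coeff n| ≤ 1) ∧
    P * invert P + Q * invert Q = C (2 * 2 ^ m) := by
  induction m with
  | zero =>
    have h1 : (1 : ℝ[T;T⁻¹]).SupportedIn 0 0 := by simpa using SupportedIn.T 0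
    have h2 : ∀ n, |(1 : ℝ[T;T⁻¹]).coeff n| ≤ 1 := by
      intro n
      rw [← T_zero, T_apply]
      split_ifs <;> simp
    refine ⟨1, 1, by simpa using h1, by simpa using h1, h2, h2, ?_⟩
    simp [one_add_one_eq_two, map_ofNat C 2]
  | succ m ih =>
    obtain ⟨P, Q, hP, hQ, hP1, hQ1, h⟩ := ih
    have hQ' : (T (2 ^ m) * Q).SupportedIn (2 ^ m) (2 ^ (m + 1) - 1) :=
      ((SupportedIn.T (2 ^ m)).mul hQ).mono (by simp) (by rw [pow_succ]; linarith)
    have hpos : (0 : ℤ) < 2 ^ m := by positivity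
    have hP2 : P.SupportedIn 0 (2 ^ (m + 1) - 1) :=
      hP.mono le_rfl (by rw [pow_succ]; linarith)
    have hQ2 : (T (2 ^ m) * Q).SupportedIn 0 (2 ^ (m + 1) - 1) := hQ'.mono hpos.le le_rfl
    have hQT : ∀ n, |(T (2 ^ m) * Q).coeff n| ≤ 1 := fun n => by
      rw [coeff_T_mul]; exact hQ1 _
    refine ⟨P + T (2 ^ m) * Q, P - T (2 ^ m) * Q, hP2.add hQ2, hP2.sub hQ2, ?_, ?_, ?_⟩
    · intro n
      rw [AddMonoidAlgebra.coeff_add, Finsupp.add_apply]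
      rcases lt_or_ge n (2 ^ m) with hn | hn
      · rw [hQ'.coeff_eq_zero (Or.inl hn), add_zero]; exact hP1 n
      · rw [hP.coeff_eq_zero (Or.inr (by omega)), zero_add]; exact hQT n
    · intro n
      rw [AddMonoidAlgebra.coeff_sub, Finsupp.sub_apply]
      rcases lt_or_ge n (2 ^ m) with hn | hn
      · rw [hQ'.coeff_eq_zero (Or.inl hn), sub_zero]; exact hP1 n
      · rw [hP.coeff_eq_zero (Or.inr (by omega)), zero_sub, abs_neg]; exact hQT n
    · have hT := T_mul_T_neg (2 ^ m)
      have hC : (C (2 * 2 ^ (m + 1)) : ℝ[T;T⁻¹]) = 2 * C (2 * 2 ^ m) := by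
        rw [pow_succ', ← mul_assoc, mul_assoc, map_mul, map_ofNat C 2]
      rw [hC, ← h]
      simp only [map_add, map_sub, map_mul, invert_T]
      linear_combination (2 * Q * invert Q) * hT

/-- Evaluation of a Laurent polynomial with real coefficients at the point `θ` of the circle. -/
noncomputable def circleEval (θ : AddCircle (1 : ℝ)) : ℝ[T;T⁻¹] →ₐ[ℝ] ℂ :=
  AddMonoidAlgebra.lift ℝ ℂ ℤ
    { toFun := fun n => fourier n.toAdd θ
      map_one' := by simp
      map_mul' := fun _ _ => fourier_add }

lemma circleEval_eq_sum (θ : AddCircle (1 : ℝ)) (p : ℝ[T;T⁻¹]) :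
    circleEval θ p = ∑ n ∈ p.coeff.support, (p.coeff n : ℂ) * fourier n θ := by
  rw [circleEval, AddMonoidAlgebra.lift_apply', Finsupp.sum]
  rfl

lemma circleEval_C (θ : AddCircle (1 : ℝ)) (r : ℝ) : circleEval θ (C r) = r := by
  rw [C_eq_algebraMap, AlgHom.commutes]; rfl

lemma circleEval_T (θ : AddCircle (1 : ℝ)) (n : ℤ) : circleEval θ (T n) = fourier n θ := by
  rw [T, circleEval, AddMonoidAlgebra.lift_single]
  simp

lemma circleEval_invert (θ : AddCircle (1 : ℝ)) (p : ℝ[T;T⁻¹]) :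
    circleEval θ (invert p) = starRingEnd ℂ (circleEval θ p) := by
  induction p using LaurentPolynomial.induction_on' with
  | add p q hp hq => simp [hp, hq]
  | C_mul_T n r => simp [circleEval_C, circleEval_T, fourier_neg, -fourier_apply]

lemma circleEval_mul_invert (θ : AddCircle (1 : ℝ)) (p : ℝ[T;T⁻¹]) :
    circleEval θ (p * invert p) = ((‖circleEval θ p‖ ^ 2 : ℝ) : ℂ) := by
  rw [map_mul, circleEval_invert, Complex.mul_conj, Complex.normSq_eq_norm_sq]

/-- Flat Laurent polynomials supported in `[N, 2N)` and correlating with a given `g`. -/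
lemma exists_flat_block (g : ℝ[T;T⁻¹]) (hg : g.coeff 0 = 1) (D : ℤ) :
    ∃ (N : ℤ) (P : ℝ[T;T⁻¹]), D < N ∧ P.SupportedIn N (2 * N - 1) ∧
      (∀ n, |P.coeff n| ≤ 1 / √(2 * N)) ∧ (∀ θ, ‖circleEval θ P‖ ≤ 1) ∧
      1 / 2 ≤ (P * invert P * g).coeff 0 := by
  obtain ⟨m, hm⟩ : ∃ m : ℕ, D < 2 ^ m :=
    pow_unbounded_of_one_lt D (by norm_num)
  obtain ⟨P, Q, hP, hQ, hP1, hQ1, h⟩ := exists_rudin_shapiro m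
  set N : ℤ := 2 ^ m with hN
  have hNpos : (0 : ℝ) < 2 * N := by rw [hN]; positivity
  set r : ℝ := 1 / √(2 * N) with hr
  have hrr : r * r * (2 * 2 ^ m) = 1 := by
    have : (2 * 2 ^ m : ℝ) = 2 * N := by rw [hN]; push_cast; rfl
    rw [this, hr, div_mul_div_comm, Real.mul_self_sqrt hNpos.le]
    rw [one_mul, one_div_mul_eq_div, div_self hNpos.ne']
  have hr0 : 0 ≤ r := by positivity
  have hid : ∀ R : ℝ[T;T⁻¹], (C r * (T N * R)) * invert (C r * (T N * R)) =
      C (r * r) * (R * invert R) := by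
    intro R
    simp only [map_mul, invert_T, invert_C]
    linear_combination (C r * C r * R * invert R) * T_mul_T_neg N
  have hsum : (C r * (T N * P)) * invert (C r * (T N * P)) +
      (C r * (T N * Q)) * invert (C r * (T N * Q)) = 1 := by
    rw [hid, hid, ← mul_add, h, ← map_mul, hrr, map_one]
  have hsupp : ∀ R : ℝ[T;T⁻¹], R.SupportedIn 0 (N - 1) →
      (C r * (T N * R)).SupportedIn N (2 * N - 1) := fun R hR =>
    (((SupportedIn.T N).mul hR).const_mul r).mono (by simp) (by linarith)
  have hcoeff : ∀ R : ℝ[T;T⁻¹], (∀ n, |R.coeff n| ≤ 1) →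
      ∀ n, |(C r * (T N * R)).coeff n| ≤ r := by
    intro R hR n
    rw [coeff_C_mul, coeff_T_mul, abs_mul, abs_of_nonneg hr0]
    exact mul_le_of_le_one_right hr0 (hR _)
  have heval : ∀ R S : ℝ[T;T⁻¹], R * invert R + S * invert S = 1 →
      ∀ θ, ‖circleEval θ R‖ ≤ 1 := by
    intro R S hRS θ
    have h1 := congrArg (circleEval θ) hRS
    rw [map_add, circleEval_mul_invert, circleEval_mul_invert, map_one] at h1
    have h2 : ‖circleEval θ R‖ ^ 2 + ‖circleEval θ S‖ ^ 2 = 1 := by exact_mod_cast h1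
    nlinarith [sq_nonneg ‖circleEval θ S‖, norm_nonneg (circleEval θ R)]
  have hcorr : ((C r * (T N * P)) * invert (C r * (T N * P)) * g).coeff 0 +
      ((C r * (T N * Q)) * invert (C r * (T N * Q)) * g).coeff 0 = 1 := by
    rw [← Finsupp.add_apply, ← AddMonoidAlgebra.coeff_add, ← add_mul, hsum, one_mul, hg]
  rcases le_total (1 / 2) (((C r * (T N * P)) * invert (C r * (T N * P)) * g).coeff 0)
    with hle | hle
  · exact ⟨N, _, hm, hsupp P hP, hcoeff P hP1, heval _ _ hsum, hle⟩
  · exact ⟨N, _, hm, hsupp Q hQ, hcoeff Q hQ1, heval _ _ ((add_comm _ _).trans hsum),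
      by linarith⟩

/-- Inductive construction: with `g` as an auxiliary companion, `f` grows slowly in sup norm,
while its pairing with the sequence `U`, dominated by `1/√n`, grows linearly in `k`. -/
lemma exists_bounded_with_large_pairing (a : ℝ) (ha : 0 ≤ a) (k : ℕ) :
    ∃ (f g U : ℝ[T;T⁻¹]) (D : ℤ), 0 < D ∧ f.SupportedIn 1 D ∧ U.SupportedIn 1 D ∧
      g.SupportedIn (-D) D ∧ g.coeff 0 = 1 ∧ (∀ n, |U.coeff n| ≤ 1 / √|(n : ℝ)|) ∧
      (∀ θ, ‖circleEval θ f‖ ^ 2 + ‖circleEval θ g‖ ^ 2 ≤ (1 + a ^ 2) ^ k) ∧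
      k * (a / 2) ≤ (f * invert U).coeff 0 := by
  induction k with
  | zero =>
    have h0 : (0 : ℝ[T;T⁻¹]).SupportedIn 1 1 := fun n hn => by simp at hn
    have h1 : (1 : ℝ[T;T⁻¹]).SupportedIn 0 0 := by simpa using SupportedIn.T 0
    refine ⟨0, 1, 0, 1, one_pos, h0, h0, h1.mono (by simp) (by simp), ?_, ?_, ?_, ?_⟩
    · rw [← T_zero, T_apply]; simp
    · intro n
      simp
    · simp
    · simp
  | succ k ih =>
    obtain ⟨f, g, U, D, hD, hf, hU, hg, hg0, hU1, hE, hpair⟩ := ih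
    obtain ⟨N, P, hN, hP, hP1, hPE, hPg⟩ := exists_flat_block g hg0 (2 * D)
    have hPi := hP.invert
    refine ⟨f + C a * (P * g), g - C a * (invert P * f), U + P, 4 * N, by omega,
      (hf.mono le_rfl (by omega)).add (((hP.mul hg).const_mul a).mono (by omega) (by omega)),
      (hU.mono le_rfl (by omega)).add (hP.mono (by omega) (by omega)),
      (hg.mono (by omega) (by omega)).sub
        (((hPi.mul hf).const_mul a).mono (by omega) (by omega)), ?_, ?_, ?_, ?_⟩
    · rw [AddMonoidAlgebra.coeff_sub, Finsupp.sub_apply, coeff_C_mul,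
        (hPi.mul hf).coeff_eq_zero (Or.inr (by omega)), hg0]
      simp
    · intro n
      rw [AddMonoidAlgebra.coeff_add, Finsupp.add_apply]
      rcases lt_or_ge n N with hn | hn
      · rw [hP.coeff_eq_zero (Or.inl hn), add_zero]; exact hU1 n
      · rw [hU.coeff_eq_zero (Or.inr (by omega)), zero_add]
        by_cases h2 : n ≤ 2 * N - 1
        · have hn0 : (0 : ℝ) < n := by exact_mod_cast (by omega : 0 < n)
          have hn1 : (n : ℝ) ≤ 2 * N := by exact_mod_cast (by omega : n ≤ 2 * N)
          refine (hP1 n).trans ?_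
          rw [abs_of_pos hn0]
          gcongr
        · rw [hP.coeff_eq_zero (Or.inr (by omega)), abs_zero]
          positivity
    · intro θ
      have hid : (f + C a * (P * g)) * invert (f + C a * (P * g)) +
          (g - C a * (invert P * f)) * invert (g - C a * (invert P * f)) =
          (f * invert f + g * invert g) * (1 + C a * C a * (P * invert P)) := by
        simp only [map_add, map_sub, map_mul, invert_C, involutive_invert P]
        ring
      generalize f + C a * (P * g) = f' at hid ⊢
      generalize g - C a * (invert P * f) = g' at hid ⊢
      have h1 := congrArg (circleEval θ) hid
      rw [map_add, circleEval_mul_invert, circleEval_mul_invert, map_mul, map_add,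
        circleEval_mul_invert, circleEval_mul_invert, map_add, map_one, map_mul,
        circleEval_mul_invert, map_mul, circleEval_C] at h1
      norm_cast at h1
      rw [h1, pow_succ]
      have hP2 : ‖circleEval θ P‖ ^ 2 ≤ 1 := pow_le_one₀ (norm_nonneg _) (hPE θ)
      have ha2 : 0 ≤ a * a := mul_self_nonneg a
      have hone : 0 ≤ 1 + a ^ 2 := by positivity
      refine mul_le_mul (hE θ) ?_ (by positivity) (pow_nonneg hone k)
      nlinarith [mul_le_mul_of_nonneg_left hP2 (mul_self_nonneg a)]
    · have e : (f + C a * (P * g)) * invert (U + P) =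
          f * invert U + f * invert P + C a * (P * g * invert U) +
            C a * (P * invert P * g) := by
        simp only [map_add]; ring
      rw [e]
      simp only [AddMonoidAlgebra.coeff_add, Finsupp.add_apply, coeff_C_mul]
      rw [(hf.mul hPi).coeff_eq_zero (Or.inr (by omega)),
        ((hP.mul hg).mul hU.invert).coeff_eq_zero (Or.inl (by omega))]
      push_cast
      nlinarith

lemma coeff_mul_invert_zero (f U : ℝ[T;T⁻¹]) :
    (f * invert U).coeff 0 = ∑ n ∈ f.coeff.support, f.coeff n * U.coeff n := by
  have h : f * invert U = ∑ n ∈ f.coeff.support, C (f.coeff n) * (T n * invert U) := by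
    conv_lhs => rw [← AddMonoidAlgebra.sum_coeff_single f]
    rw [Finsupp.sum, Finset.sum_mul]
    simp only [single_eq_C_mul_T, mul_assoc]
  rw [h, AddMonoidAlgebra.coeff_sum, Finsupp.finsetSum_apply]
  refine Finset.sum_congr rfl fun n _ => ?_
  rw [coeff_C_mul, coeff_T_mul, invert_apply]
  simp

lemma fourierCoeff_circleEval (p : ℝ[T;T⁻¹]) (n : ℤ) :
    fourierCoeff (fun θ => circleEval θ p) n = p.coeff n := by
  have h : (fun θ => circleEval θ p) =
      ∑ m ∈ p.coeff.support, fun θ : AddCircle (1 : ℝ) => (p.coeff m : ℂ) * fourier m θ := by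
    ext θ
    rw [circleEval_eq_sum, Finset.sum_apply]
  rw [h, fourierCoeff.sum _ _ fun m _ => ?_, Finset.sum_apply]
  · simp only [fourierCoeff.const_mul, fourierCoeff_fourier]
    simp only [Pi.single_apply, mul_ite, mul_one, mul_zero, Finset.sum_ite_eq]
    split_ifs with hn
    · rfl
    · simp [Finsupp.notMem_support_iff.1 hn]
  · exact (continuous_const.mul (fourier m).continuous).integrable_of_hasCompactSupport
      (HasCompactSupport.of_compactSpace _)

end LaurentPolynomial

/-- The sequence `m(n) = 1/√|n|` (`n ≠ 0`), `m(0) = 0`, is **not** a Sidon weight on `𝕋`: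
for every `S > 0` there is a trigonometric polynomial `f` with `f̂(0) = 0` such that
`∑_{n ≠ 0} |f̂ n|/√|n| > S ‖f‖_{L^∞(𝕋)}`. -/
theorem reciprocal_sqrt_weight_not_sidon_weight :
    ∀ S : ℝ, 0 < S →
      ∃ f : AddCircle (1 : ℝ) → ℂ,
        (∃ (F : Finset ℤ) (c : ℤ → ℂ), f = fun θ => ∑ n ∈ F, c n * fourier n θ) ∧
        fourierCoeff f 0 = 0 ∧
        (∑' n : {n : ℤ // n ≠ 0}, ‖fourierCoeff f (n : ℤ)‖ / Real.sqrt |((n : ℤ) : ℝ)|)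
          > S * ⨆ θ, ‖f θ‖ := by
  intro S hS
  obtain ⟨k, hk⟩ := exists_nat_gt (16 * S ^ 2)
  have hk0 : (0 : ℝ) < k := lt_trans (by positivity) hk
  have hsq : √(k : ℝ) ^ 2 = k := Real.sq_sqrt hk0.le
  have hsk : 0 < √(k : ℝ) := Real.sqrt_pos.2 hk0
  obtain ⟨f, g, U, D, hD, hf, hU, hg, hg0, hU1, hE, hpair⟩ :=
    LaurentPolynomial.exists_bounded_with_large_pairing (1 / √k) (by positivity) k
  have hf0 : f.coeff 0 = 0 := hf.coeff_eq_zero (Or.inl one_pos)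
  refine ⟨fun θ => LaurentPolynomial.circleEval θ f, ⟨f.coeff.support, fun n => f.coeff n,
    funext fun θ => LaurentPolynomial.circleEval_eq_sum θ f⟩, ?_, ?_⟩
  · rw [LaurentPolynomial.fourierCoeff_circleEval, hf0, Complex.ofReal_zero]
  have hsup : ⨆ θ, ‖LaurentPolynomial.circleEval θ f‖ ≤ 2 := by
    refine ciSup_le fun θ => ?_
    have h1 : (1 + (1 / √(k : ℝ)) ^ 2) ^ k ≤ Real.exp 1 := by
      rw [div_pow, hsq, one_pow]
      calc (1 + 1 / (k : ℝ)) ^ k ≤ (Real.exp (1 / k)) ^ k := by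
            gcongr
            rw [add_comm]
            exact Real.add_one_le_exp _
        _ = Real.exp 1 := by
            rw [← Real.exp_nat_mul, mul_one_div_cancel hk0.ne']
    have h2 := hE θ
    nlinarith [Real.exp_one_lt_d9, sq_nonneg ‖LaurentPolynomial.circleEval θ g‖, norm_nonneg (LaurentPolynomial.circleEval θ f)]
  have hlower : √(k : ℝ) / 2 ≤
      ∑' n : {n : ℤ // n ≠ 0}, ‖(f.coeff (n : ℤ) : ℂ)‖ / √|((n : ℤ) : ℝ)| := by
    have hts := tsum_subtype {n : ℤ | n ≠ 0} fun n => ‖(f.coeff n : ℂ)‖ / √|(n : ℝ)|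
    refine le_of_le_of_eq ?_ hts.symm
    rw [tsum_eq_sum (s := f.coeff.support)]
    · calc √(k : ℝ) / 2 = k * (1 / √k / 2) := by
            field_simp
            exact hsq
        _ ≤ _ := hpair
        _ = _ := LaurentPolynomial.coeff_mul_invert_zero f U
        _ ≤ _ := Finset.sum_le_sum fun n hn => by
            have hn0 : n ≠ 0 := by
              rintro rfl
              exact Finsupp.mem_support_iff.1 hn hf0
            rw [Set.indicator_of_mem (show n ∈ {n : ℤ | n ≠ 0} from hn0), Complex.norm_real,
              Real.norm_eq_abs, div_eq_mul_one_div]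
            refine (le_abs_self _).trans ?_
            rw [abs_mul]
            exact mul_le_mul_of_nonneg_left (hU1 n) (abs_nonneg _)
    · intro n hn
      simp [Set.indicator, Finsupp.notMem_support_iff.1 hn]
  simp only [LaurentPolynomial.fourierCoeff_circleEval]
  have h4 : 4 * S < √(k : ℝ) := Real.lt_sqrt_of_sq_lt (by linarith [mul_pow 4 S 2])
  have h5 := mul_le_mul_of_nonneg_left hsup hS.le
  linarith
end
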